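/- Let {L₁,…,L₆} be a real Schläfli six, i.e., six pairwise skew lines in RP³ lying on a nonsingular cubic surface, and suppose that every 5-element subconfiguration {L₁,…,L₆}∖{Lᵢ} has signature of absolute value 2 (the tripartite case). Then the configuration {L₁,…,L₆} is coarse deformation equivalent to the join configuration J(214365), i.e., it is deformation equivalent either to J(214365) or to a mirror image of J(214365). -/

import Mathlib

open Submodule

abbrev V4 : Type := Fin 4 → ℝ

abbrev PLine : Type := Submodule ℝ V4

def IsLine (P : PLine) : Prop := Module.finrank ℝ P = 2

def Skew (P Q : PLine) : Prop := IsLine P ∧ IsLine Q ∧ P ⊓ Q = ⊥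

def PairwiseSkew {n : ℕ} (L : Fin n → PLine) : Prop :=
  ∀ i j : Fin n, i ≠ j → Skew (L i) (L j)

noncomputable def det2 (a b c d : V4) : ℝ := Matrix.det (Matrix.of ![a, b, c, d])

open Classical in
noncomputable def lk (P Q R : PLine) : ℝ :=
  if h : ∃ v : Fin 6 → V4,
      P = span ℝ {v 0, v 1} ∧ Q = span ℝ {v 2, v 3} ∧ R = span ℝ {v 4, v 5} then
    Real.sign (det2 (h.choose 0) (h.choose 1) (h.choose 2) (h.choose 3) *
      det2 (h.choose 0) (h.choose 1) (h.choose 4) (h.choose 5) *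
      det2 (h.choose 2) (h.choose 3) (h.choose 4) (h.choose 5))
  else 0

noncomputable def sgnOf {n : ℕ} (L : Fin n → PLine) : ℝ :=
  ∑ i : Fin n, ∑ j : Fin n, ∑ k : Fin n,
    if i < j ∧ j < k then lk (L i) (L j) (L k) else 0

def ContinuousLineFamily (L : ℝ → PLine) : Prop :=
  ∃ v w : ℝ → V4, ContinuousOn v (Set.Icc 0 1) ∧ ContinuousOn w (Set.Icc 0 1) ∧
    ∀ t ∈ Set.Icc (0:ℝ) 1, L t = span ℝ {v t, w t}

def Deformation {n : ℕ} (L L' : Fin n → PLine) : Prop :=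
  ∃ F : ℝ → Fin n → PLine,
    (∀ i, ContinuousLineFamily (fun t => F t i)) ∧
    (∀ t ∈ Set.Icc (0:ℝ) 1, PairwiseSkew (F t)) ∧
    F 0 = L ∧ F 1 = L'

def DeformEquiv {n : ℕ} (L L' : Fin n → PLine) : Prop :=
  ∃ π π' : Equiv.Perm (Fin n), Deformation (L ∘ π) (L' ∘ π')

def IsMirror {n : ℕ} (L L' : Fin n → PLine) : Prop :=
  ∃ A : V4 →ₗ[ℝ] V4, LinearMap.det A < 0 ∧ ∀ i, L' i = (L i).map A

def CoarseDeformEquiv {n : ℕ} (L L' : Fin n → PLine) : Prop :=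
  DeformEquiv L L' ∨ ∃ M : Fin n → PLine, IsMirror L' M ∧ DeformEquiv L M

noncomputable def joinConfig {n : ℕ} (σ : Equiv.Perm (Fin n)) : Fin n → PLine :=
  fun i => span ℝ {![1, (i.val : ℝ) + 1, 0, 0], ![0, 0, ((σ i).val : ℝ) + 1, 1]}

def IsSchlafliSix (L : Fin 6 → PLine) : Prop :=
  PairwiseSkew L ∧
  ∃ F : MvPolynomial (Fin 4) ℝ,
    F ≠ 0 ∧ F.IsHomogeneous 3 ∧
    (∀ i : Fin 6, ∀ x ∈ L i, MvPolynomial.eval x F = 0) ∧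
    (∀ z : Fin 4 → ℂ, z ≠ 0 →
      MvPolynomial.eval z (MvPolynomial.map (algebraMap ℝ ℂ) F) = 0 →
      ∃ j : Fin 4, MvPolynomial.eval z (MvPolynomial.map (algebraMap ℝ ℂ) (MvPolynomial.pderiv j F)) ≠ 0)

def Reducible {n : ℕ} (L : Fin n → PLine) : Prop :=
  ∃ i j : Fin n, i ≠ j ∧ ∃ F : ℝ → Fin n → PLine,
    (∀ k, ContinuousLineFamily (fun t => F t k)) ∧
    F 0 = L ∧
    (∀ t ∈ Set.Ico (0:ℝ) 1, PairwiseSkew (F t)) ∧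
    F 1 i = F 1 j ∧
    (∀ k l : Fin n, k ≠ l → ¬(k = i ∧ l = j) → ¬(k = j ∧ l = i) → Skew (F 1 k) (F 1 l))

/-! ### Determinants and skewness -/

lemma det2_apply (a b c d : V4) : det2 a b c d =
    (a 0 * b 1 - a 1 * b 0) * (c 2 * d 3 - c 3 * d 2)
    - (a 0 * b 2 - a 2 * b 0) * (c 1 * d 3 - c 3 * d 1)
    + (a 0 * b 3 - a 3 * b 0) * (c 1 * d 2 - c 2 * d 1)
    + (a 1 * b 2 - a 2 * b 1) * (c 0 * d 3 - c 3 * d 0)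
    - (a 1 * b 3 - a 3 * b 1) * (c 0 * d 2 - c 2 * d 0)
    + (a 2 * b 3 - a 3 * b 2) * (c 0 * d 1 - c 1 * d 0) := by
  simp [det2, Matrix.det_succ_row_zero, Fin.sum_univ_succ, Fin.succAbove]
  ring

lemma det2_swap (a b c d : V4) : det2 c d a b = det2 a b c d := by
  rw [det2_apply, det2_apply]; ring

lemma det2_comb_left (a b c d : V4) (p q r s : ℝ) :
    det2 (p • a + q • b) (r • a + s • b) c d = (p * s - q * r) * det2 a b c d := by
  simp only [det2_apply, Pi.add_apply, Pi.smul_apply, smul_eq_mul]; ring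

lemma det2_map (M : V4 →ₗ[ℝ] V4) (a b c d : V4) :
    det2 (M a) (M b) (M c) (M d) = LinearMap.det M * det2 a b c d := by
  rw [← LinearMap.det_toMatrix', mul_comm, det2, det2, ← Matrix.det_transpose (LinearMap.toMatrix' M),
    ← Matrix.det_mul]
  congr 1
  ext i j
  have h : ∀ v : V4, M v j = ∑ k, v k * LinearMap.toMatrix' M j k := by
    intro v
    conv_lhs => rw [← LinearMap.toMatrix'_mulVec M v]
    simp [Matrix.mulVec, dotProduct, mul_comm]
  rw [Matrix.mul_apply]
  fin_cases i <;> exact h _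

lemma linearIndependent_of_det2_ne_zero {a b c d : V4} (h : det2 a b c d ≠ 0) :
    LinearIndependent ℝ ![a, b, c, d] := by
  have := (Matrix.linearIndependent_rows_iff_isUnit (A := Matrix.of ![a, b, c, d])).2
    ((Matrix.isUnit_iff_isUnit_det _).2 (isUnit_iff_ne_zero.2 h))
  exact this

lemma det2_ne_zero_of_linearIndependent {a b c d : V4} (h : LinearIndependent ℝ ![a, b, c, d]) :
    det2 a b c d ≠ 0 := by
  have := (Matrix.linearIndependent_rows_iff_isUnit (A := Matrix.of ![a, b, c, d])).1 h
  exact isUnit_iff_ne_zero.1 ((Matrix.isUnit_iff_isUnit_det _).1 this)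

lemma isLine_span {a b : V4} (h : LinearIndependent ℝ ![a, b]) : IsLine (span ℝ {a, b}) := by
  have := finrank_span_eq_card h
  rwa [Matrix.range_cons, Matrix.range_cons, Matrix.range_empty, Set.union_empty,
    Set.singleton_union] at this

lemma exists_span_of_isLine {P : PLine} (h : IsLine P) :
    ∃ a b : V4, P = span ℝ {a, b} ∧ LinearIndependent ℝ ![a, b] := by
  have : FiniteDimensional ℝ P := inferInstance
  let B := Module.finBasisOfFinrankEq ℝ P h
  refine ⟨B 0, B 1, ?_, ?_⟩
  · have h1 := B.span_eq
    have h2 : span ℝ (Set.range (fun i => (B i : V4))) = P := by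
      have := congrArg (Submodule.map P.subtype) h1
      rw [Submodule.map_span, ← Set.range_comp, Submodule.map_subtype_top] at this
      exact this
    refine h2.symm.trans (congrArg _ ?_)
    ext x; simp [Fin.exists_fin_two, eq_comm]
  · have := B.linearIndependent.map' P.subtype (Submodule.ker_subtype P)
    have e : ![(B 0 : V4), (B 1 : V4)] = P.subtype ∘ B := by
      ext i : 1
      fin_cases i <;> rfl
    rw [e]; exact this

lemma comb_eq_zero {a b c d : V4} (h : det2 a b c d ≠ 0) {p q r s : ℝ}
    (e : p • a + q • b + r • c + s • d = 0) : p = 0 ∧ q = 0 ∧ r = 0 ∧ s = 0 := by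
  have := Fintype.linearIndependent_iff.1 (linearIndependent_of_det2_ne_zero h) ![p, q, r, s]
    (by simpa [Fin.sum_univ_four] using e)
  exact ⟨this 0, this 1, this 2, this 3⟩

lemma linearIndependent_pair {a b c d : V4} (h : det2 a b c d ≠ 0) :
    LinearIndependent ℝ ![a, b] := by
  rw [LinearIndependent.pair_iff]
  intro s t e
  have := comb_eq_zero h (p := s) (q := t) (r := 0) (s := 0) (by simpa using e)
  exact ⟨this.1, this.2.1⟩

lemma skew_of_det2_ne_zero {a b c d : V4} (h : det2 a b c d ≠ 0) :
    Skew (span ℝ {a, b}) (span ℝ {c, d}) := by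
  refine ⟨isLine_span (linearIndependent_pair h),
    isLine_span (linearIndependent_pair (c := a) (d := b) (by rwa [det2_swap])), ?_⟩
  rw [eq_bot_iff]
  rintro x ⟨h1, h2⟩
  obtain ⟨p, q, rfl⟩ := Submodule.mem_span_pair.1 h1
  obtain ⟨r, s, e⟩ := Submodule.mem_span_pair.1 h2
  have := comb_eq_zero h (p := p) (q := q) (r := -r) (s := -s)
    (by rw [add_assoc, ← e]; module)
  simp [this.1, this.2.1]

lemma det2_ne_zero_of_skew {a b c d : V4} (h : Skew (span ℝ {a, b}) (span ℝ {c, d})) :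
    det2 a b c d ≠ 0 := by
  obtain ⟨h1, h2, h3⟩ := h
  apply det2_ne_zero_of_linearIndependent
  have e : Submodule.span ℝ (Set.range ![a, b, c, d]) = span ℝ {a, b} ⊔ span ℝ {c, d} := by
    rw [← Submodule.span_union]
    congr 1
    ext x; simp; tauto
  apply linearIndependent_of_top_le_span_of_card_eq_finrank
  · have hs := Submodule.finrank_sup_add_finrank_inf_eq (span ℝ {a, b}) (span ℝ {c, d})
    rw [h3, finrank_bot, h1, h2] at hs
    rw [e, top_le_iff]
    apply Submodule.eq_top_of_finrank_eq
    rw [Module.finrank_fin_fun]; simpa using hs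
  · simp

/-! ### Linking indices -/

lemma det2_eq_mul_of_span_le {a b a' b' : V4} (h : span ℝ {a', b'} ≤ span ℝ {a, b}) :
    ∃ c : ℝ, ∀ x y, det2 a' b' x y = c * det2 a b x y := by
  obtain ⟨p, q, e1⟩ := Submodule.mem_span_pair.1 (h (subset_span (Set.mem_insert a' {b'})))
  obtain ⟨r, s, e2⟩ := Submodule.mem_span_pair.1
    (h (subset_span (Set.mem_insert_of_mem a' (Set.mem_singleton b'))))
  exact ⟨p * s - q * r, fun x y => by rw [← e1, ← e2, det2_comb_left]⟩

lemma lk_eq {a b c d e f : V4} (h1 : det2 a b c d ≠ 0) (h2 : det2 a b e f ≠ 0) :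
    lk (span ℝ {a, b}) (span ℝ {c, d}) (span ℝ {e, f}) =
      SignType.sign (det2 a b c d * det2 a b e f * det2 c d e f) := by
  have hex : ∃ v : Fin 6 → V4, span ℝ {a, b} = span ℝ {v 0, v 1} ∧
      span ℝ {c, d} = span ℝ {v 2, v 3} ∧ span ℝ {e, f} = span ℝ {v 4, v 5} :=
    ⟨![a, b, c, d, e, f], rfl, rfl, rfl⟩
  rw [lk, dif_pos hex]
  obtain ⟨g1, g2, g3⟩ := hex.choose_spec
  generalize hex.choose = v at *
  obtain ⟨p, hp⟩ := det2_eq_mul_of_span_le g1.ge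
  obtain ⟨q, hq⟩ := det2_eq_mul_of_span_le g2.ge
  obtain ⟨r, hr⟩ := det2_eq_mul_of_span_le g3.ge
  have s1 := det2_ne_zero_of_skew (g1 ▸ g2 ▸ skew_of_det2_ne_zero h1)
  have s2 := det2_ne_zero_of_skew (g1 ▸ g3 ▸ skew_of_det2_ne_zero h2)
  have e1 : det2 (v 0) (v 1) (v 2) (v 3) = p * q * det2 a b c d := by
    rw [hp, det2_swap, hq, det2_swap, mul_assoc]
  have e2 : det2 (v 0) (v 1) (v 4) (v 5) = p * r * det2 a b e f := by
    rw [hp, det2_swap, hr, det2_swap, mul_assoc]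
  have e3 : det2 (v 2) (v 3) (v 4) (v 5) = q * r * det2 c d e f := by
    rw [hq, det2_swap, hr, det2_swap, mul_assoc]
  have hpqr : 0 < (p * q * r) ^ 2 := by
    refine sq_pos_of_ne_zero ?_
    rintro h0
    rcases mul_eq_zero.1 h0 with h0 | h0
    · exact s1 (by rw [e1, h0, zero_mul])
    · exact s2 (by rw [e2, h0, mul_zero, zero_mul])
  rw [e1, e2, e3, show p * q * det2 a b c d * (p * r * det2 a b e f) * (q * r * det2 c d e f) =
    (p * q * r) ^ 2 * (det2 a b c d * det2 a b e f * det2 c d e f) by ring]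
  generalize det2 a b c d * det2 a b e f * det2 c d e f = D
  rcases lt_trichotomy D 0 with h | h | h
  · rw [Real.sign_of_neg (mul_neg_of_pos_of_neg hpqr h), sign_neg h]; simp
  · simp [h]
  · rw [Real.sign_of_pos (mul_pos hpqr h), sign_pos h]; simp

/-! ### Concatenation of deformations -/

lemma ContinuousLineFamily.exists_continuous {L : ℝ → PLine} (h : ContinuousLineFamily L) :
    ∃ v w : ℝ → V4, Continuous v ∧ Continuous w ∧
      ∀ t ∈ Set.Icc (0 : ℝ) 1, L t = span ℝ {v t, w t} := by
  obtain ⟨v, w, hv, hw, h⟩ := h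
  refine ⟨Set.IccExtend zero_le_one ((Set.Icc 0 1).domRestrict v),
    Set.IccExtend zero_le_one ((Set.Icc 0 1).domRestrict w), ?_, ?_, fun t ht => ?_⟩
  · exact (continuousOn_iff_continuous_domRestrict.1 hv).Icc_extend'
  · exact (continuousOn_iff_continuous_domRestrict.1 hw).Icc_extend'
  · rw [Set.IccExtend_of_mem _ _ ht, Set.IccExtend_of_mem _ _ ht, h t ht]; rfl

lemma span_comb_eq {a b : V4} {p q r s : ℝ} (h : p * s - q * r ≠ 0) :
    span ℝ {p • a + q • b, r • a + s • b} = span ℝ {a, b} := by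
  apply le_antisymm
  · rw [span_le]
    rintro x (rfl | rfl)
    · exact Submodule.mem_span_pair.2 ⟨p, q, rfl⟩
    · exact Submodule.mem_span_pair.2 ⟨r, s, rfl⟩
  · rw [span_le]
    rintro x (hx | hx)
    · rw [hx]
      refine Submodule.mem_span_pair.2 ⟨s / (p * s - q * r), -q / (p * s - q * r), ?_⟩
      ext i
      simp only [Pi.add_apply, Pi.smul_apply, smul_eq_mul]
      linear_combination a i * inv_mul_cancel₀ h
    · rw [hx]
      refine Submodule.mem_span_pair.2 ⟨-r / (p * s - q * r), p / (p * s - q * r), ?_⟩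
      ext i
      simp only [Pi.add_apply, Pi.smul_apply, smul_eq_mul]
      linear_combination b i * inv_mul_cancel₀ h

lemma exists_comb_of_span_eq {a b a' b' : V4} (h : span ℝ {a, b} = span ℝ {a', b'})
    (hl : IsLine (span ℝ {a, b})) :
    ∃ p q r s : ℝ, p * s - q * r ≠ 0 ∧ a = p • a' + q • b' ∧ b = r • a' + s • b' := by
  obtain ⟨p, q, e1⟩ := Submodule.mem_span_pair.1
    (h.le (subset_span (Set.mem_insert a {b})))
  obtain ⟨r, s, e2⟩ := Submodule.mem_span_pair.1
    (h.le (subset_span (Set.mem_insert_of_mem a (Set.mem_singleton b))))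
  refine ⟨p, q, r, s, fun h0 => ?_, e1.symm, e2.symm⟩
  have hli : LinearIndependent ℝ ![a, b] := by
    rw [linearIndependent_iff_card_eq_finrank_span, Set.finrank, Matrix.range_cons,
      Matrix.range_cons, Matrix.range_empty, Set.union_empty, Set.singleton_union, hl]
    simp
  rw [LinearIndependent.pair_iff] at hli
  have k1 := hli s (-q) (by
    rw [← e1, ← e2]
    rw [show s • (p • a' + q • b') + -q • (r • a' + s • b') = (p * s - q * r) • a' by module,
      h0, zero_smul])
  have k2 := hli (-r) p (by
    rw [← e1, ← e2]
    rw [show -r • (p • a' + q • b') + p • (r • a' + s • b') = (p * s - q * r) • b' by module,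
      h0, zero_smul])
  have : a = 0 := by rw [← e1, k2.2, neg_eq_zero.1 k1.2]; simp
  have := hli 1 0 (by simp [this])
  simp at this

lemma ContinuousLineFamily.trans {L₁ L₂ : ℝ → PLine} (h₁ : ContinuousLineFamily L₁)
    (h₂ : ContinuousLineFamily L₂) (h : L₁ 1 = L₂ 0) (hl : IsLine (L₂ 0)) :
    ContinuousLineFamily (fun t => if t ≤ 1 / 2 then L₁ (2 * t) else L₂ (2 * t - 1)) := by
  obtain ⟨v₁, w₁, hv₁, hw₁, e₁⟩ := h₁.exists_continuous
  obtain ⟨v₂, w₂, hv₂, hw₂, e₂⟩ := h₂.exists_continuous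
  have k₁ := e₁ 1 (by simp)
  have k₂ := e₂ 0 (by simp)
  obtain ⟨p, q, r, s, hd, ea, eb⟩ := exists_comb_of_span_eq (k₁.symm.trans (h.trans k₂))
    (by rw [← k₁, h]; exact hl)
  refine ⟨fun t => if t ≤ 1 / 2 then v₁ (2 * t) else p • v₂ (2 * t - 1) + q • w₂ (2 * t - 1),
    fun t => if t ≤ 1 / 2 then w₁ (2 * t) else r • v₂ (2 * t - 1) + s • w₂ (2 * t - 1),
    Continuous.continuousOn ?_, Continuous.continuousOn ?_, ?_⟩
  · refine Continuous.if_le (by fun_prop) (by fun_prop) (by fun_prop) (by fun_prop) ?_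
    rintro t rfl
    norm_num [ea]
  · refine Continuous.if_le (by fun_prop) (by fun_prop) (by fun_prop) (by fun_prop) ?_
    rintro t rfl
    norm_num [eb]
  · rintro t ⟨ht0, ht1⟩
    dsimp only
    split_ifs with ht
    · exact e₁ _ ⟨by linarith, by linarith⟩
    · push Not at ht
      rw [span_comb_eq hd]
      exact e₂ _ ⟨by linarith, by linarith⟩

lemma Deformation.trans {n : ℕ} {L L' L'' : Fin n → PLine} (h₁ : Deformation L L')
    (h₂ : Deformation L' L'') (hl : ∀ i, IsLine (L' i)) : Deformation L L'' := by
  obtain ⟨F, hF, sF, F0, F1⟩ := h₁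
  obtain ⟨G, hG, sG, G0, G1⟩ := h₂
  refine ⟨fun t => if t ≤ 1 / 2 then F (2 * t) else G (2 * t - 1), fun i => ?_, ?_, ?_, ?_⟩
  · have := (hF i).trans (hG i) (by rw [F1, G0]) (by rw [G0]; exact hl i)
    convert this using 2 with t
    dsimp only; split_ifs <;> rfl
  · rintro t ⟨ht0, ht1⟩
    dsimp only
    split_ifs with ht
    · exact sF _ ⟨by linarith, by linarith⟩
    · push Not at ht
      exact sG _ ⟨by linarith, by linarith⟩
  · norm_num [F0]
  · norm_num [G1]

lemma Skew.map {P Q : PLine} (h : Skew P Q) {M : V4 →ₗ[ℝ] V4} (hM : LinearMap.det M ≠ 0) :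
    Skew (P.map M) (Q.map M) := by
  obtain ⟨a, b, rfl, -⟩ := exists_span_of_isLine h.1
  obtain ⟨c, d, rfl, -⟩ := exists_span_of_isLine h.2.1
  simp only [Submodule.map_span, Set.image_pair]
  exact skew_of_det2_ne_zero (by rw [det2_map]; exact mul_ne_zero hM (det2_ne_zero_of_skew h))

lemma Deformation.map {n : ℕ} {L L' : Fin n → PLine} (h : Deformation L L')
    {M : V4 →ₗ[ℝ] V4} (hM : LinearMap.det M ≠ 0) :
    Deformation (fun i => (L i).map M) (fun i => (L' i).map M) := by
  obtain ⟨F, hF, sF, F0, F1⟩ := h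
  refine ⟨fun t i => (F t i).map M, fun i => ?_, fun t ht i j hij => (sF t ht i j hij).map hM,
    by simp [F0], by simp [F1]⟩
  obtain ⟨v, w, hv, hw, h⟩ := hF i
  have hc : Continuous M := M.continuous_of_finiteDimensional
  refine ⟨fun t => M (v t), fun t => M (w t), hc.comp_continuousOn hv, hc.comp_continuousOn hw,
    fun t ht => ?_⟩
  simp only [h t ht, Submodule.map_span, Set.image_pair]

/-! ### Invertible matrices of positive determinant are connected to the identity -/

/-- The matrix of a reflection in the first coordinate. -/
def reflectionMatrix : Matrix (Fin 4) (Fin 4) ℝ := Matrix.diagonal ![-1, 1, 1, 1]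

/-- `M` is connected by a path of invertible matrices to the identity or to a fixed reflection. -/
def ConnectedToStandard (M : Matrix (Fin 4) (Fin 4) ℝ) : Prop :=
  ∃ γ : ℝ → Matrix (Fin 4) (Fin 4) ℝ, Continuous γ ∧ γ 0 = M ∧
    (γ 1 = 1 ∨ γ 1 = reflectionMatrix) ∧ ∀ t ∈ Set.Icc (0 : ℝ) 1, (γ t).det ≠ 0

lemma reflectionMatrix_mul_self : reflectionMatrix * reflectionMatrix = 1 := by
  rw [reflectionMatrix, Matrix.diagonal_mul_diagonal, ← Matrix.diagonal_one]
  congr 1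
  ext i; fin_cases i <;> simp

lemma ConnectedToStandard.mul {A B : Matrix (Fin 4) (Fin 4) ℝ} (hA : ConnectedToStandard A)
    (hB : ConnectedToStandard B) : ConnectedToStandard (A * B) := by
  obtain ⟨α, hα, α0, α1, dα⟩ := hA
  obtain ⟨β, hβ, β0, β1, dβ⟩ := hB
  refine ⟨fun t => α t * β t, hα.matrix_mul hβ, by simp only [α0, β0], ?_, fun t ht => ?_⟩
  · rcases α1 with h | h <;> rcases β1 with h' | h' <;> simp [h, h', reflectionMatrix_mul_self]
  · rw [Matrix.det_mul]; exact mul_ne_zero (dα t ht) (dβ t ht)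

lemma connectedToStandard_transvection (t : Matrix.TransvectionStruct (Fin 4) ℝ) :
    ConnectedToStandard t.toMatrix := by
  obtain ⟨i, j, hij, c⟩ := t
  refine ⟨fun t => Matrix.transvection i j ((1 - t) * c), ?_, by simp, by simp, fun t _ => by
    simp [hij]⟩
  simp only [Matrix.transvection]
  refine continuous_const.add (continuous_matrix fun a b => ?_)
  simp only [Matrix.single_apply]
  split_ifs <;> fun_prop

lemma connectedToStandard_diagonal_pos {d : Fin 4 → ℝ} (hd : ∀ i, 0 < d i) :
    ConnectedToStandard (Matrix.diagonal d) := by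
  refine ⟨fun t => Matrix.diagonal fun i => (1 - t) * d i + t, ?_, by simp, Or.inl ?_, ?_⟩
  · exact Continuous.matrix_diagonal (by fun_prop)
  · simp
  · rintro t ⟨h0, h1⟩
    rw [Matrix.det_diagonal]
    refine (Finset.prod_pos fun i _ => ?_).ne'
    rcases h1.eq_or_lt with rfl | h1
    · simp
    · have := mul_pos (sub_pos.2 h1) (hd i); linarith

lemma connectedToStandard_flip (i : Fin 4) :
    ConnectedToStandard (Matrix.diagonal (Function.update 1 i (-1))) := by
  have key : ∀ t : ℝ, (1 - 2 * t) * ((1 - 2 * t)) + t * (1 - t) * (t * (1 - t)) ≠ 0 := by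
    intro t h
    have h1 : (1 - 2 * t) ^ 2 = 0 := by nlinarith [sq_nonneg (1 - 2 * t), sq_nonneg (t * (1 - t))]
    have h2 : t = 1 / 2 := by linarith [pow_eq_zero_iff (two_ne_zero) |>.1 h1]
    subst h2; norm_num at h
  fin_cases i
  · refine ⟨fun _ => reflectionMatrix, continuous_const, ?_, Or.inr rfl, fun t _ => ?_⟩
    · refine congrArg Matrix.diagonal (funext fun j => ?_)
      fin_cases j <;> simp
    · simp [reflectionMatrix, Matrix.det_diagonal, Fin.prod_univ_succ]
  · refine ⟨fun t => !![1 - 2 * t, t * (1 - t), 0, 0; t * (1 - t), -(1 - 2 * t), 0, 0;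
      0, 0, 1, 0; 0, 0, 0, 1], ?_, ?_, Or.inr ?_, fun t _ => ?_⟩
    · refine continuous_matrix fun a b => ?_
      fin_cases a <;> fin_cases b <;> simp <;> fun_prop
    · ext a b; fin_cases a <;> fin_cases b <;> simp [Matrix.diagonal]
    · ext a b; fin_cases a <;> fin_cases b <;> norm_num [Matrix.diagonal, reflectionMatrix]
    · have := key t
      contrapose! this
      rw [← neg_eq_zero, ← this]
      simp [Matrix.det_succ_row_zero, Fin.sum_univ_succ, Fin.succAbove]
      ring
  · refine ⟨fun t => !![1 - 2 * t, 0, t * (1 - t), 0; 0, 1, 0, 0;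
      t * (1 - t), 0, -(1 - 2 * t), 0; 0, 0, 0, 1], ?_, ?_, Or.inr ?_, fun t _ => ?_⟩
    · refine continuous_matrix fun a b => ?_
      fin_cases a <;> fin_cases b <;> simp <;> fun_prop
    · ext a b; fin_cases a <;> fin_cases b <;> simp [Matrix.diagonal]
    · ext a b; fin_cases a <;> fin_cases b <;> norm_num [Matrix.diagonal, reflectionMatrix]
    · have := key t
      contrapose! this
      rw [← neg_eq_zero, ← this]
      simp [Matrix.det_succ_row_zero, Fin.sum_univ_succ, Fin.succAbove]
      ring
  · refine ⟨fun t => !![1 - 2 * t, 0, 0, t * (1 - t); 0, 1, 0, 0;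
      0, 0, 1, 0; t * (1 - t), 0, 0, -(1 - 2 * t)], ?_, ?_, Or.inr ?_, fun t _ => ?_⟩
    · refine continuous_matrix fun a b => ?_
      fin_cases a <;> fin_cases b <;> simp <;> fun_prop
    · ext a b; fin_cases a <;> fin_cases b <;> simp [Matrix.diagonal]
    · ext a b; fin_cases a <;> fin_cases b <;> norm_num [Matrix.diagonal, reflectionMatrix]
    · have := key t
      contrapose! this
      rw [← neg_eq_zero, ← this]
      simp [Matrix.det_succ_row_zero, Fin.sum_univ_succ, Fin.succAbove]
      ring

lemma connectedToStandard_diagonal_sign (s : Finset (Fin 4)) :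
    ConnectedToStandard (Matrix.diagonal fun i => if i ∈ s then -1 else 1) := by
  induction s using Finset.induction_on with
  | empty =>
    have := connectedToStandard_diagonal_pos (d := 1) (by simp)
    simpa using this
  | insert i s hi ih =>
    have := (connectedToStandard_flip i).mul ih
    rw [Matrix.diagonal_mul_diagonal] at this
    refine (congrArg (fun v => ConnectedToStandard (Matrix.diagonal v))
      (funext fun j => ?_)).mpr this
    by_cases hj : j = i
    · subst hj; simp [hi]
    · simp [hj]

lemma connectedToStandard_of_det_ne_zero {M : Matrix (Fin 4) (Fin 4) ℝ} (h : M.det ≠ 0) :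
    ConnectedToStandard M := by
  refine Matrix.diagonal_transvection_induction_of_det_ne_zero _ M h (fun d hd => ?_)
    connectedToStandard_transvection fun A B _ _ => ConnectedToStandard.mul
  have hd' : ∀ i, d i ≠ 0 := by
    rw [Matrix.det_diagonal, Finset.prod_ne_zero_iff] at hd
    exact fun i => hd i (Finset.mem_univ i)
  have := (connectedToStandard_diagonal_pos fun i => abs_pos.2 (hd' i)).mul
    (connectedToStandard_diagonal_sign (Finset.univ.filter fun i => d i < 0))
  rw [Matrix.diagonal_mul_diagonal] at this
  convert this using 2
  ext i
  by_cases hi : d i < 0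
  · simp [hi, abs_of_neg hi]
  · simp [hi, abs_of_nonneg (not_lt.1 hi)]

lemma exists_path_of_det_pos {M : Matrix (Fin 4) (Fin 4) ℝ} (h : 0 < M.det) :
    ∃ γ : ℝ → Matrix (Fin 4) (Fin 4) ℝ, Continuous γ ∧ γ 0 = M ∧ γ 1 = 1 ∧
      ∀ t ∈ Set.Icc (0 : ℝ) 1, (γ t).det ≠ 0 := by
  obtain ⟨γ, hγ, h0, h1, hd⟩ := connectedToStandard_of_det_ne_zero h.ne'
  refine ⟨γ, hγ, h0, h1.resolve_right fun h1 => ?_, hd⟩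
  have hc : ContinuousOn (fun t => (γ t).det) (Set.Icc 0 1) := hγ.matrix_det.continuousOn
  obtain ⟨t, ht, e⟩ := intermediate_value_Icc' zero_le_one hc
    (show (0 : ℝ) ∈ Set.Icc _ _ from ⟨by
      simp [h1, reflectionMatrix, Matrix.det_diagonal, Fin.prod_univ_succ], by rw [h0]; exact h.le⟩)
  exact hd t ht e

lemma PairwiseSkew.deformation_map {n : ℕ} {L : Fin n → PLine} (hL : PairwiseSkew L)
    (hl : ∀ i, IsLine (L i)) {M : V4 →ₗ[ℝ] V4} (hM : 0 < LinearMap.det M) :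
    Deformation (fun i => (L i).map M) L := by
  rw [← LinearMap.det_toMatrix'] at hM
  obtain ⟨γ, hγ, h0, h1, hd⟩ := exists_path_of_det_pos hM
  refine ⟨fun t i => (L i).map (Matrix.toLin' (γ t)), fun i => ?_, fun t ht i j hij => ?_, ?_, ?_⟩
  · obtain ⟨a, b, e, -⟩ := exists_span_of_isLine (hl i)
    refine ⟨fun t => (γ t).mulVec a, fun t => (γ t).mulVec b,
      (hγ.matrix_mulVec continuous_const).continuousOn,
      (hγ.matrix_mulVec continuous_const).continuousOn, fun t _ => ?_⟩
    simp [e, Submodule.map_span, Set.image_pair]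
  · exact (hL i j hij).map (by rw [LinearMap.det_toLin']; exact hd t ht)
  · simp [h0]
  · simp [h1]

/-! ### Cubic surfaces and trilinear forms -/

/-- A symmetric trilinear form on `ℝ⁴`. -/
structure SymmTrilinear where
  toFun : V4 → V4 → V4 → ℝ
  add_left : ∀ x x' y z, toFun (x + x') y z = toFun x y z + toFun x' y z
  smul_left : ∀ (c : ℝ) x y z, toFun (c • x) y z = c * toFun x y z
  swap_left : ∀ x y z, toFun x y z = toFun y x z
  swap_right : ∀ x y z, toFun x y z = toFun x z y

namespace SymmTrilinear

variable (T : SymmTrilinear)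

lemma add_mid (x y y' z : V4) : T.toFun x (y + y') z = T.toFun x y z + T.toFun x y' z := by
  rw [T.swap_left, T.add_left, T.swap_left y, T.swap_left y']

lemma smul_mid (c : ℝ) (x y z : V4) : T.toFun x (c • y) z = c * T.toFun x y z := by
  rw [T.swap_left, T.smul_left, T.swap_left y]

lemma add_right (x y z z' : V4) : T.toFun x y (z + z') = T.toFun x y z + T.toFun x y z' := by
  rw [T.swap_right, T.add_mid, T.swap_right x z, T.swap_right x z']

lemma smul_right (c : ℝ) (x y z : V4) : T.toFun x y (c • z) = c * T.toFun x y z := by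
  rw [T.swap_right, T.smul_mid, T.swap_right x z]

lemma cube_comb (x y : V4) (t : ℝ) : T.toFun (x + t • y) (x + t • y) (x + t • y) =
    T.toFun x x x + 3 * t * T.toFun x x y + 3 * t ^ 2 * T.toFun x y y + t ^ 3 * T.toFun y y y := by
  simp only [add_left, add_mid, add_right, smul_left, smul_mid, smul_right]
  rw [T.swap_left y x x, T.swap_right x y x, T.swap_left y x y, T.swap_right y y x,
    T.swap_left y x y]
  ring

lemma square_comb (x y z w : V4) (t : ℝ) : T.toFun (x + t • y) (x + t • y) (z + t • w) =
    T.toFun x x z + t * (2 * T.toFun x y z + T.toFun x x w)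
      + t ^ 2 * (T.toFun y y z + 2 * T.toFun x y w) + t ^ 3 * T.toFun y y w := by
  simp only [add_left, add_mid, add_right, smul_left, smul_mid, smul_right]
  rw [T.swap_left y x z, T.swap_left y x w]
  ring

lemma square_smul_comb (x y z : V4) (s t : ℝ) : T.toFun (s • x + t • y) (s • x + t • y) z =
    s ^ 2 * T.toFun x x z + 2 * s * t * T.toFun x y z + t ^ 2 * T.toFun y y z := by
  simp only [add_left, add_mid, smul_left, smul_mid]
  rw [T.swap_left y x z]
  ring

lemma mixed_eq_zero {x y : V4} (h : ∀ t : ℝ, T.toFun (x + t • y) (x + t • y) (x + t • y) = 0)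
    (hy : T.toFun y y y = 0) : T.toFun x x y = 0 := by
  have h0 := h 0
  have h1 := h 1
  have h2 := h (-1)
  rw [cube_comb] at h0 h1 h2
  linarith

/-- Three pairwise skew lines, spanned by `u₁, u₂`, by `w₁, w₂` and by `u₁ + w₁, u₂ + w₂`, span a
quadric; a symmetric cubic vanishing on the lines and on four further lines of the other ruling
has a singular point on it. -/
lemma exists_singular {u₁ u₂ w₁ w₂ : V4} (hd : det2 u₁ u₂ w₁ w₂ ≠ 0)
    (hu : ∀ x ∈ span ℝ {u₁, u₂}, T.toFun x x x = 0)
    (hw : ∀ x ∈ span ℝ {w₁, w₂}, T.toFun x x x = 0)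
    (huw : ∀ x ∈ span ℝ {u₁ + w₁, u₂ + w₂}, T.toFun x x x = 0)
    {m n : ℝ} (hmn : m ≠ n) (hm : m ≠ 0) (hn : n ≠ 0) {a d l k : ℝ}
    (ha0 : a ≠ 0) (ha1 : a ≠ 1) (hd0 : d ≠ 0) (hd1 : d ≠ 1)
    (hl0 : l ≠ 0) (hl1 : l ≠ 1) (hk0 : k ≠ 0) (hk1 : k ≠ 1)
    (ha : T.toFun (u₁ + a • w₁) (u₁ + a • w₁) (u₁ + a • w₁) = 0)
    (hdd : T.toFun (u₂ + d • w₂) (u₂ + d • w₂) (u₂ + d • w₂) = 0)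
    (hl : T.toFun ((u₁ + m • u₂) + l • (w₁ + m • w₂)) ((u₁ + m • u₂) + l • (w₁ + m • w₂))
      ((u₁ + m • u₂) + l • (w₁ + m • w₂)) = 0)
    (hk : T.toFun ((u₁ + n • u₂) + k • (w₁ + n • w₂)) ((u₁ + n • u₂) + k • (w₁ + n • w₂))
      ((u₁ + n • u₂) + k • (w₁ + n • w₂)) = 0) :
    ∃ p : V4, p ≠ 0 ∧ ∀ y, T.toFun p p y = 0 := by
  have mu : ∀ t : ℝ, u₁ + t • u₂ ∈ span ℝ {u₁, u₂} := fun t =>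
    Submodule.mem_span_pair.2 ⟨1, t, by simp⟩
  have mw : ∀ t : ℝ, w₁ + t • w₂ ∈ span ℝ {w₁, w₂} := fun t =>
    Submodule.mem_span_pair.2 ⟨1, t, by simp⟩
  have mu2 : u₂ ∈ span ℝ {u₁, u₂} := subset_span (by simp)
  have mw2 : w₂ ∈ span ℝ {w₁, w₂} := subset_span (by simp)
  have key : ∀ U W : V4, T.toFun U U U = 0 → T.toFun W W W = 0 →
      T.toFun (U + W) (U + W) (U + W) = 0 → T.toFun U U W + T.toFun U W W = 0 := by
    intro U W h1 h2 h3
    have := T.cube_comb U W 1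
    rw [one_smul, h1, h2, h3] at this
    linarith
  have key2 : ∀ U W : V4, ∀ c : ℝ, T.toFun U U U = 0 → T.toFun W W W = 0 →
      T.toFun (U + W) (U + W) (U + W) = 0 → c ≠ 0 → c ≠ 1 →
      T.toFun (U + c • W) (U + c • W) (U + c • W) = 0 → T.toFun U U W = 0 := by
    intro U W c h1 h2 h3 h4 h5 h6
    have := key U W h1 h2 h3
    rw [T.cube_comb, h1, h2] at h6
    have h7 : c * (1 - c) * T.toFun U U W = 0 := by linear_combination h6 / 3 - c ^ 2 * this
    exact (mul_eq_zero.1 h7).resolve_left (mul_ne_zero h4 (sub_ne_zero.2 h5.symm))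
  have muw : ∀ t : ℝ, (u₁ + t • u₂) + (w₁ + t • w₂) ∈ span ℝ {u₁ + w₁, u₂ + w₂} := fun t =>
    Submodule.mem_span_pair.2 ⟨1, t, by module⟩
  have muw2 : u₂ + w₂ ∈ span ℝ {u₁ + w₁, u₂ + w₂} := subset_span (by simp)
  have hu1 := hu _ (mu 0)
  have hw1 := hw _ (mw 0)
  have huw1 := huw _ (muw 0)
  simp only [zero_smul, add_zero] at hu1 hw1 huw1
  have c1 := key2 _ _ a hu1 hw1 huw1 ha0 ha1 ha
  have c2 := key2 _ _ d (hu _ mu2) (hw _ mw2) (huw _ muw2) hd0 hd1 hdd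
  have cm := key2 _ _ l (hu _ (mu m)) (hw _ (mw m)) (huw _ (muw m)) hl0 hl1 hl
  have cn := key2 _ _ k (hu _ (mu n)) (hw _ (mw n)) (huw _ (muw n)) hk0 hk1 hk
  rw [T.square_comb, c1, c2] at cm cn
  have hβ : T.toFun u₂ u₂ w₁ + 2 * T.toFun u₁ u₂ w₂ = 0 := by
    have : m * n * (m - n) * (T.toFun u₂ u₂ w₁ + 2 * T.toFun u₁ u₂ w₂) = 0 := by
      linear_combination n * cm - m * cn
    exact (mul_eq_zero.1 this).resolve_left
      (mul_ne_zero (mul_ne_zero hm hn) (sub_ne_zero.2 hmn))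
  have hα : 2 * T.toFun u₁ u₂ w₁ + T.toFun u₁ u₁ w₂ = 0 := by
    rw [hβ] at cm
    simpa [hm] using cm
  have e1 := key _ _ hu1 hw1 huw1
  have e2 := key _ _ (hu _ mu2) (hw _ mw2) (huw _ muw2)
  have e3 := key _ _ (hu _ (mu 1)) (hw _ (mw 1)) (huw _ (muw 1))
  have e4 := key _ _ (hu _ (mu (-1))) (hw _ (mw (-1))) (huw _ (muw (-1)))
  have sw : ∀ x y z : V4, T.toFun x y z = T.toFun y z x := fun x y z => by
    rw [T.swap_left, T.swap_right]
  rw [sw (u₁ + (1 : ℝ) • u₂) (w₁ + (1 : ℝ) • w₂), T.square_comb, T.square_comb, c1, c2, hα, hβ] at e3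
  rw [sw (u₁ + (-1 : ℝ) • u₂) (w₁ + (-1 : ℝ) • w₂), T.square_comb, T.square_comb, c1, c2, hα, hβ]
    at e4
  have e1' : T.toFun w₁ w₁ u₁ = 0 := by rw [c1, sw u₁] at e1; linarith
  have e2' : T.toFun w₂ w₂ u₂ = 0 := by rw [c2, sw u₂] at e2; linarith
  have hγ : 2 * T.toFun w₁ w₂ u₁ + T.toFun w₁ w₁ u₂ = 0 := by linarith
  have z1 := T.mixed_eq_zero (fun t => hu _ (mu t)) (hu _ mu2)
  have z2 := T.mixed_eq_zero (fun t => hw _ (mw t)) (hw _ mw2)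
  have hT (s t : ℝ) (y : V4) := T.square_smul_comb u₁ w₁ y s t
  have r1 : T.toFun u₁ w₁ u₁ = 0 := by rw [T.swap_right, c1]
  have r2 : T.toFun u₁ w₁ w₁ = 0 := by rw [T.swap_left, T.swap_right, e1']
  have r3 : T.toFun u₁ w₁ u₂ = T.toFun u₁ u₂ w₁ := T.swap_right _ _ _
  have r4 : T.toFun u₁ w₁ w₂ = T.toFun w₁ w₂ u₁ := sw _ _ _
  have main : ∀ s t : ℝ, s * T.toFun u₁ u₂ w₁ = t * T.toFun w₁ w₂ u₁ →
      ∀ y, T.toFun (s • u₁ + t • w₁) (s • u₁ + t • w₁) y = 0 := by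
    intro s t hst y
    have htop := (basisOfLinearIndependentOfCardEqFinrank (linearIndependent_of_det2_ne_zero hd)
      (by simp)).span_eq
    rw [coe_basisOfLinearIndependentOfCardEqFinrank] at htop
    have hy : y ∈ span ℝ (Set.range ![u₁, u₂, w₁, w₂]) := htop ▸ Submodule.mem_top
    induction hy using Submodule.span_induction with
    | mem x hx =>
      obtain ⟨i, rfl⟩ := hx
      fin_cases i
      · change T.toFun _ _ u₁ = 0
        rw [hT, hu1, r1, e1']; ring
      · change T.toFun _ _ u₂ = 0
        rw [hT, z1, r3]
        linear_combination 2 * t * hst + t ^ 2 * hγ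
      · change T.toFun _ _ w₁ = 0
        rw [hT, c1, r2, hw1]; ring
      · change T.toFun _ _ w₂ = 0
        rw [hT, z2, r4]
        linear_combination s ^ 2 * hα - 2 * s * hst
    | zero =>
      have := T.smul_right 0 (s • u₁ + t • w₁) (s • u₁ + t • w₁) 0
      simpa using this
    | add x y _ _ hx hy => rw [T.add_right, hx, hy, add_zero]
    | smul c x _ hx => rw [T.smul_right, hx, mul_zero]
  have nz : ∀ s t : ℝ, s • u₁ + t • w₁ = 0 → s = 0 ∧ t = 0 := by
    intro s t h
    have := comb_eq_zero hd (p := s) (q := 0) (r := t) (s := 0) (by simpa using h)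
    exact ⟨this.1, this.2.2.1⟩
  by_cases h : T.toFun u₁ u₂ w₁ = 0 ∧ T.toFun w₁ w₂ u₁ = 0
  · exact ⟨(1 : ℝ) • u₁ + (0 : ℝ) • w₁, fun h0 => one_ne_zero (nz _ _ h0).1,
      main 1 0 (by rw [h.1]; ring)⟩
  · exact ⟨T.toFun w₁ w₂ u₁ • u₁ + T.toFun u₁ u₂ w₁ • w₁,
      fun h0 => h ⟨(nz _ _ h0).2, (nz _ _ h0).1⟩, main _ _ (by ring)⟩

end SymmTrilinear

namespace MvPolynomial

lemma pderiv_pderiv_comm {σ R : Type*} [CommRing R] (i j : σ) (F : MvPolynomial σ R) :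
    pderiv i (pderiv j F) = pderiv j (pderiv i F) := by
  classical
  have h : ⁅pderiv (R := R) i, pderiv j⁆ = (0 : Derivation R (MvPolynomial σ R) (MvPolynomial σ R)) := by
    refine derivation_ext fun k => ?_
    rw [Derivation.commutator_apply, pderiv_X, pderiv_X]
    simp only [Pi.single_apply]
    split_ifs <;> simp
  have := congrArg (fun D : Derivation R (MvPolynomial σ R) (MvPolynomial σ R) => D F) h
  rw [Derivation.commutator_apply] at this
  simpa [sub_eq_zero] using this

lemma IsHomogeneous.eval_eq_coeff_zero {σ R : Type*} [CommRing R] {F : MvPolynomial σ R}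
    (hF : F.IsHomogeneous 0) (x : σ → R) : eval x F = coeff 0 F := by
  rw [totalDegree_eq_zero_iff_eq_C.1 ((totalDegree_zero_iff_isHomogeneous _).2 hF)]
  simp

end MvPolynomial

/-- The symmetric trilinear form of third derivatives of a polynomial at the origin. -/
noncomputable def SymmTrilinear.ofPoly (F : MvPolynomial (Fin 4) ℝ) : SymmTrilinear where
  toFun x y z := ∑ k, ∑ j, ∑ i, x i * y j * z k *
    MvPolynomial.coeff 0 (MvPolynomial.pderiv i (MvPolynomial.pderiv j (MvPolynomial.pderiv k F)))
  add_left x x' y z := by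
    simp only [← Finset.sum_add_distrib, Pi.add_apply]
    refine Finset.sum_congr rfl fun k _ => Finset.sum_congr rfl fun j _ =>
      Finset.sum_congr rfl fun i _ => by ring
  smul_left c x y z := by
    simp only [Finset.mul_sum, Pi.smul_apply, smul_eq_mul]
    refine Finset.sum_congr rfl fun k _ => Finset.sum_congr rfl fun j _ =>
      Finset.sum_congr rfl fun i _ => by ring
  swap_left x y z := by
    refine Finset.sum_congr rfl fun k _ => ?_
    rw [Finset.sum_comm]
    refine Finset.sum_congr rfl fun j _ => Finset.sum_congr rfl fun i _ => ?_
    rw [MvPolynomial.pderiv_pderiv_comm]; ring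
  swap_right x y z := by
    rw [Finset.sum_comm]
    refine Finset.sum_congr rfl fun k _ => Finset.sum_congr rfl fun j _ =>
      Finset.sum_congr rfl fun i _ => ?_
    rw [MvPolynomial.pderiv_pderiv_comm j k]; ring

lemma SymmTrilinear.ofPoly_apply (F : MvPolynomial (Fin 4) ℝ) (x y z : V4) :
    (ofPoly F).toFun x y z = ∑ k, z k * ∑ j, y j * ∑ i, x i * MvPolynomial.coeff 0
      (MvPolynomial.pderiv i (MvPolynomial.pderiv j (MvPolynomial.pderiv k F))) := by
  simp only [ofPoly, Finset.mul_sum]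
  refine Finset.sum_congr rfl fun k _ => Finset.sum_congr rfl fun j _ =>
    Finset.sum_congr rfl fun i _ => by ring

lemma eval_pderiv_cubic {F : MvPolynomial (Fin 4) ℝ} (hF : F.IsHomogeneous 3) (x : V4)
    (k : Fin 4) : (SymmTrilinear.ofPoly F).toFun x x (Pi.single k 1) =
      2 * MvPolynomial.eval x (MvPolynomial.pderiv k F) := by
  have h1 : (MvPolynomial.pderiv k F).IsHomogeneous 2 := hF.pderiv
  have h2 (j : Fin 4) : (MvPolynomial.pderiv j (MvPolynomial.pderiv k F)).IsHomogeneous 1 :=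
    h1.pderiv
  have h3 (i j : Fin 4) : (MvPolynomial.pderiv i (MvPolynomial.pderiv j
      (MvPolynomial.pderiv k F))).IsHomogeneous 0 := (h2 j).pderiv
  have e1 := congrArg (MvPolynomial.eval x) h1.sum_X_mul_pderiv
  have e2 (j : Fin 4) := congrArg (MvPolynomial.eval x) (h2 j).sum_X_mul_pderiv
  simp only [map_sum, map_mul, MvPolynomial.eval_X, one_smul, nsmul_eq_mul,
    Nat.cast_ofNat, map_ofNat] at e1 e2
  rw [← e1]
  rw [SymmTrilinear.ofPoly_apply,
    Finset.sum_eq_single k (fun b _ hb => by rw [Pi.single_eq_of_ne hb, zero_mul]) (by simp),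
    Pi.single_eq_same, one_mul]
  refine Finset.sum_congr rfl fun j _ => ?_
  rw [← e2 j]
  congr 1
  exact Finset.sum_congr rfl fun i _ => by rw [(h3 i j).eval_eq_coeff_zero]

lemma eval_cubic {F : MvPolynomial (Fin 4) ℝ} (hF : F.IsHomogeneous 3) (x : V4) :
    (SymmTrilinear.ofPoly F).toFun x x x = 6 * MvPolynomial.eval x F := by
  have e := congrArg (MvPolynomial.eval x) hF.sum_X_mul_pderiv
  simp only [map_sum, map_mul, MvPolynomial.eval_X, nsmul_eq_mul, Nat.cast_ofNat,
    map_ofNat] at e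
  have : (SymmTrilinear.ofPoly F).toFun x x x =
      ∑ k, x k * (SymmTrilinear.ofPoly F).toFun x x (Pi.single k 1) := by
    rw [SymmTrilinear.ofPoly_apply]
    refine Finset.sum_congr rfl fun k _ => ?_
    rw [SymmTrilinear.ofPoly_apply]
    congr 1
    symm
    rw [Finset.sum_eq_single k (fun b _ hb => by rw [Pi.single_eq_of_ne hb, zero_mul]) (by simp),
      Pi.single_eq_same, one_mul]
  rw [this]
  simp only [eval_pderiv_cubic hF]
  have e' : (6 : ℝ) * MvPolynomial.eval x F = 2 * (3 * MvPolynomial.eval x F) := by ring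
  rw [e', ← e, Finset.mul_sum]
  exact Finset.sum_congr rfl fun k _ => by ring

/-- The cubic form of a Schläfli six: it vanishes on the lines and has no real singular point. -/
lemma IsSchlafliSix.exists_symmTrilinear {L : Fin 6 → PLine} (hL : IsSchlafliSix L) :
    ∃ T : SymmTrilinear, (∀ i, ∀ x ∈ L i, T.toFun x x x = 0) ∧
      ∀ p, p ≠ 0 → ∃ y, T.toFun p p y ≠ 0 := by
  obtain ⟨-, F, -, hF, hv, hs⟩ := hL
  refine ⟨SymmTrilinear.ofPoly F, fun i x hx => by rw [eval_cubic hF, hv i x hx, mul_zero],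
    fun p hp => ?_⟩
  by_contra! h
  have ev (G : MvPolynomial (Fin 4) ℝ) : MvPolynomial.eval (fun i => (p i : ℂ))
      (MvPolynomial.map (algebraMap ℝ ℂ) G) = ((MvPolynomial.eval p G : ℝ) : ℂ) := by
    rw [MvPolynomial.eval_map]
    exact (MvPolynomial.eval₂_comp _ _ _).symm
  have hz : (fun i => (p i : ℂ)) ≠ 0 := fun h0 => hp (funext fun i => by
    simpa using congrFun h0 i)
  have h0 : MvPolynomial.eval p F = 0 := by
    have := eval_cubic hF p
    rw [h p] at this
    linarith
  obtain ⟨j, hj⟩ := hs _ hz (by rw [ev, h0]; simp)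
  rw [ev] at hj
  have := eval_pderiv_cubic hF p j
  rw [h] at this
  exact hj (by rw [show MvPolynomial.eval p (MvPolynomial.pderiv j F) = 0 by linarith]; simp)

/-! ### Linking patterns -/

/-- Linking index of three indices for a sign matrix, `true` standing for `+1`. -/
def triple (e : Fin 6 → Fin 6 → Bool) (i j k : Fin 6) : Bool := xor (e i j) (xor (e i k) (e j k))

/-- The number of positively linked triples among five indices. -/
def countTriples (e : Fin 6 → Fin 6 → Bool) (f : Fin 5 → Fin 6) : ℕ :=
  (triple e (f 0) (f 1) (f 2)).toNat + (triple e (f 0) (f 1) (f 3)).toNat +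
  (triple e (f 0) (f 1) (f 4)).toNat + (triple e (f 0) (f 2) (f 3)).toNat +
  (triple e (f 0) (f 2) (f 4)).toNat + (triple e (f 0) (f 3) (f 4)).toNat +
  (triple e (f 1) (f 2) (f 3)).toNat + (triple e (f 1) (f 2) (f 4)).toNat +
  (triple e (f 1) (f 3) (f 4)).toNat + (triple e (f 2) (f 3) (f 4)).toNat

/-- The symmetric sign matrix with given entries and first row `true`. -/
def signMatrix (a b c d p q r s t u : Bool) : Fin 6 → Fin 6 → Bool :=
  ![![false, true, true, true, true, true],
    ![true, false, a, b, c, d],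
    ![true, a, false, p, q, r],
    ![true, b, p, false, s, t],
    ![true, c, q, s, false, u],
    ![true, d, r, t, u, false]]

/-- The linking pattern of the tripartite Schläfli six, relative to the index `0`. -/
def IsPattern (e : Fin 6 → Fin 6 → Bool) (π : Fin 6 → Fin 6) (δ : Bool) : Prop :=
  triple e 0 (π 1) (π 2) = δ ∧ triple e 0 (π 1) (π 3) = !δ ∧ triple e 0 (π 2) (π 3) = δ ∧
  triple e 0 (π 1) (π 4) = !δ ∧ triple e 0 (π 2) (π 4) = !δ ∧ triple e 0 (π 1) (π 5) = δ ∧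
  triple e 0 (π 2) (π 5) = !δ ∧ triple e 0 (π 3) (π 4) = !δ ∧ triple e 0 (π 3) (π 5) = δ ∧
  triple e 0 (π 4) (π 5) = !δ

instance (e : Fin 6 → Fin 6 → Bool) (π : Fin 6 → Fin 6) (δ : Bool) :
    Decidable (IsPattern e π δ) := by unfold IsPattern; infer_instance

/-- The three cyclic orders of the four non-isolated vertices. -/
def cycleOrder : Fin 3 → Equiv.Perm (Fin 6) := ![1, Equiv.swap 2 3, Equiv.swap 3 5]

/-- The number of positively linked triples among five lines with the given ten signs of pairs. -/
def pentadCount (a b c d p q r s t u : Bool) : ℕ :=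
  (xor a (xor b p)).toNat + (xor a (xor c q)).toNat + (xor a (xor d r)).toNat +
  (xor b (xor c s)).toNat + (xor b (xor d t)).toNat + (xor c (xor d u)).toNat +
  (xor p (xor q s)).toNat + (xor p (xor r t)).toNat + (xor q (xor r u)).toNat +
  (xor s (xor t u)).toNat

/-- Five lines with `n` positively linked triples have signature `2` or `-2`. -/
def isFourOrSix (n : ℕ) : Bool := n == 4 || n == 6

lemma isFourOrSix_iff {n : ℕ} : isFourOrSix n = true ↔ n = 4 ∨ n = 6 := by simp [isFourOrSix]

set_option maxRecDepth 100000 in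
lemma exists_isPattern_of_pentadCount : ∀ a b c d p q r s t u : Bool,
    (isFourOrSix (pentadCount a b c d p q r s t u) &&
      (isFourOrSix (pentadCount true true true true p q r s t u) &&
      (isFourOrSix (pentadCount true true true true b c d s t u) &&
      (isFourOrSix (pentadCount true true true true a c d q r u) &&
      (isFourOrSix (pentadCount true true true true a b d p r t) &&
      isFourOrSix (pentadCount true true true true a b c p q s)))))) = true →
    ∃ (j : Fin 5) (k : Fin 3) (δ : Bool), IsPattern (signMatrix a b c d p q r s t u)
      (Equiv.swap 4 j.succ * cycleOrder k : Equiv.Perm (Fin 6)) δ := by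
  decide +kernel

lemma exists_isPattern_signMatrix (a b c d p q r s t u : Bool)
    (h : ∀ m : Fin 6, countTriples (signMatrix a b c d p q r s t u) m.succAbove = 4 ∨
      countTriples (signMatrix a b c d p q r s t u) m.succAbove = 6) :
    ∃ (j : Fin 5) (k : Fin 3) (δ : Bool), IsPattern (signMatrix a b c d p q r s t u)
      (Equiv.swap 4 j.succ * cycleOrder k : Equiv.Perm (Fin 6)) δ := by
  apply exists_isPattern_of_pentadCount
  simp only [Bool.and_eq_true, isFourOrSix_iff]
  exact ⟨h 0, h 1, h 2, h 3, h 4, h 5⟩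

lemma PairwiseSkew.exists_frames {L : Fin 6 → PLine} (hL : PairwiseSkew L) :
    ∃ a b : Fin 6 → V4, (∀ i, L i = span ℝ {a i, b i}) ∧
      (∀ i j, i ≠ j → det2 (a i) (b i) (a j) (b j) ≠ 0) ∧
      ∀ j, j ≠ 0 → 0 < det2 (a 0) (b 0) (a j) (b j) := by
  have hl (i : Fin 6) : IsLine (L i) := by
    rcases eq_or_ne i 0 with rfl | hi
    · exact (hL 0 1 (by decide)).1
    · exact (hL i 0 hi).1
  choose a b hab _ using fun i => exists_span_of_isLine (hl i)
  have hne : ∀ i j, i ≠ j → det2 (a i) (b i) (a j) (b j) ≠ 0 := fun i j hij =>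
    det2_ne_zero_of_skew (by rw [← hab, ← hab]; exact hL i j hij)
  have hex : ∀ j, ∃ p q : V4, L j = span ℝ {p, q} ∧
      (j = 0 → p = a 0 ∧ q = b 0) ∧ (j ≠ 0 → 0 < det2 (a 0) (b 0) p q) := by
    intro j
    by_cases hj : j = 0
    · subst hj
      exact ⟨a 0, b 0, hab 0, fun _ => ⟨rfl, rfl⟩, fun h => absurd rfl h⟩
    · rcases (hne 0 j (Ne.symm hj)).lt_or_gt with h | h
      · refine ⟨b j, a j, by rw [hab, Set.pair_comm], fun h => absurd h hj, fun _ => ?_⟩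
        have : det2 (a 0) (b 0) (b j) (a j) = -det2 (a 0) (b 0) (a j) (b j) := by
          rw [det2_apply, det2_apply]; ring
        linarith
      · exact ⟨a j, b j, hab j, fun h => absurd h hj, fun _ => h⟩
  choose a' b' h1 h2 h3 using hex
  refine ⟨a', b', h1, fun i j hij => det2_ne_zero_of_skew (by rw [← h1, ← h1]; exact hL i j hij),
    fun j hj => ?_⟩
  rw [(h2 0 rfl).1, (h2 0 rfl).2]
  exact h3 j hj

lemma eq_signMatrix {e : Fin 6 → Fin 6 → Bool} (hdiag : ∀ i, e i i = false)
    (hsymm : ∀ i j, e j i = e i j) (hrow : ∀ j, j ≠ 0 → e 0 j = true) :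
    e = signMatrix (e 1 2) (e 1 3) (e 1 4) (e 1 5) (e 2 3) (e 2 4) (e 2 5) (e 3 4) (e 3 5)
      (e 4 5) := by
  funext i j
  fin_cases i <;> fin_cases j <;>
    first
    | rfl
    | exact hdiag _
    | exact hrow _ (by decide)
    | exact hsymm _ _
    | exact (hsymm _ _).trans (hrow _ (by decide))

/-- After relabelling, the linking indices with the line `0` follow the tripartite pattern. -/
lemma PairwiseSkew.exists_pattern {L : Fin 6 → PLine} (hL : PairwiseSkew L)
    (hsig : ∀ i : Fin 6, |sgnOf (L ∘ i.succAbove)| = 2) :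
    ∃ (π : Equiv.Perm (Fin 6)) (δ : ℝ), (δ = 1 ∨ δ = -1) ∧
      lk (L (π 0)) (L (π 1)) (L (π 2)) = δ ∧ lk (L (π 0)) (L (π 1)) (L (π 3)) = -δ ∧
      lk (L (π 0)) (L (π 2)) (L (π 3)) = δ ∧ lk (L (π 0)) (L (π 1)) (L (π 4)) = -δ ∧
      lk (L (π 0)) (L (π 2)) (L (π 4)) = -δ ∧ lk (L (π 0)) (L (π 1)) (L (π 5)) = δ ∧
      lk (L (π 0)) (L (π 2)) (L (π 5)) = -δ ∧ lk (L (π 0)) (L (π 3)) (L (π 4)) = -δ ∧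
      lk (L (π 0)) (L (π 3)) (L (π 5)) = δ ∧ lk (L (π 0)) (L (π 4)) (L (π 5)) = -δ := by
  obtain ⟨a, b, hab, hne, h0⟩ := hL.exists_frames
  set e : Fin 6 → Fin 6 → Bool := fun i j => decide (0 < det2 (a i) (b i) (a j) (b j)) with he
  have hsymm (i j : Fin 6) : e j i = e i j := by simp only [he, det2_swap (a i)]
  have hdiag (i : Fin 6) : e i i = false := by
    have : det2 (a i) (b i) (a i) (b i) = 0 := by rw [det2_apply]; ring
    simp [he, this]
  have hrow (j : Fin 6) (hj : j ≠ 0) : e 0 j = true := by simpa [he] using h0 j hj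
  have hsm : e = signMatrix (e 1 2) (e 1 3) (e 1 4) (e 1 5) (e 2 3) (e 2 4) (e 2 5) (e 3 4) (e 3 5)
      (e 4 5) :=
    eq_signMatrix hdiag hsymm hrow
  have hlk {i j k : Fin 6} (hij : i ≠ j) (hik : i ≠ k) (hjk : j ≠ k) :
      lk (L i) (L j) (L k) = 2 * ((triple e i j k).toNat : ℝ) - 1 := by
    rw [hab i, hab j, hab k, lk_eq (hne i j hij) (hne i k hik)]
    rcases (hne i j hij).lt_or_gt with h1 | h1 <;> rcases (hne i k hik).lt_or_gt with h2 | h2 <;>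
      rcases (hne j k hjk).lt_or_gt with h3 | h3 <;>
      simp [triple, he, sign_mul, h1, h2, h3, h1.not_gt, h2.not_gt, h3.not_gt] <;>
      norm_num
  have hcount (m : Fin 6) : sgnOf (L ∘ m.succAbove) = 2 * countTriples e m.succAbove - 10 := by
    have hs {i j k : Fin 5} (hij : i ≠ j) (hik : i ≠ k) (hjk : j ≠ k) :=
      hlk (m.succAbove_right_injective.ne hij) (m.succAbove_right_injective.ne hik)
        (m.succAbove_right_injective.ne hjk)
    simp only [sgnOf, Fin.sum_univ_five, Function.comp_apply]
    simp +decide only [if_true, if_false]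
    rw [hs (i := 0) (j := 1) (k := 2) (by decide) (by decide) (by decide)]
    simp only [countTriples, Nat.cast_add]
    simp +decide [hs]
    ring
  obtain ⟨j, k, δ, h⟩ := exists_isPattern_signMatrix (e 1 2) (e 1 3) (e 1 4) (e 1 5) (e 2 3) (e 2 4)
    (e 2 5) (e 3 4) (e 3 5) (e 4 5) (by
      rw [← hsm]
      intro m
      have := hsig m
      rw [hcount, abs_eq (by norm_num)] at this
      rcases this with h | h
      · right
        have : (countTriples e m.succAbove : ℝ) = (6 : ℕ) := by push_cast; linarith
        exact_mod_cast this
      · left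
        have : (countTriples e m.succAbove : ℝ) = (4 : ℕ) := by push_cast; linarith
        exact_mod_cast this)
  rw [← hsm] at h
  set π := Equiv.swap 4 j.succ * cycleOrder k with hπ
  have hπ0 : π 0 = 0 := by
    have h1 : ∀ j : Fin 5, ∀ k, (Equiv.swap 4 j.succ * cycleOrder k) 0 = 0 := by decide
    exact h1 j k
  have hnot : 2 * ((!δ).toNat : ℝ) - 1 = -(2 * (δ.toNat : ℝ) - 1) := by cases δ <;> norm_num
  have hp {i j : Fin 6} (hi : 0 ≠ i) (hj : 0 ≠ j) (hij : i ≠ j) :=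
    hlk (i := π 0) (π.injective.ne hi) (π.injective.ne hj) (π.injective.ne hij)
  obtain ⟨g1, g2, g3, g4, g5, g6, g7, g8, g9, g10⟩ := h
  refine ⟨π, 2 * (δ.toNat : ℝ) - 1, by cases δ <;> norm_num, ?_⟩
  refine ⟨?_, ?_, ?_, ?_, ?_, ?_, ?_, ?_, ?_, ?_⟩ <;>
    rw [hp (by decide) (by decide) (by decide), hπ0] <;>
    simp only [g1, g2, g3, g4, g5, g6, g7, g8, g9, g10, hnot]

/-! ### Normal form -/

/-- The line that is the graph of the matrix `(a b; c d)`, as a map from the span of `u₁, u₂` to the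
span of `w₁, w₂`. -/
def graphLine (u₁ u₂ w₁ w₂ : V4) (a b c d : ℝ) : PLine :=
  span ℝ {u₁ + a • w₁ + c • w₂, u₂ + b • w₁ + d • w₂}

lemma det2_graph_graph (u₁ u₂ w₁ w₂ : V4) (a b c d a' b' c' d' : ℝ) :
    det2 (u₁ + a • w₁ + c • w₂) (u₂ + b • w₁ + d • w₂)
      (u₁ + a' • w₁ + c' • w₂) (u₂ + b' • w₁ + d' • w₂) =
    ((a - a') * (d - d') - (b - b') * (c - c')) * det2 u₁ u₂ w₁ w₂ := by
  simp only [det2_apply, Pi.add_apply, Pi.smul_apply, smul_eq_mul]; ring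

lemma det2_graph (u₁ u₂ w₁ w₂ : V4) (a b c d : ℝ) :
    det2 w₁ w₂ (u₁ + a • w₁ + c • w₂) (u₂ + b • w₁ + d • w₂) = det2 u₁ u₂ w₁ w₂ := by
  simp only [det2_apply, Pi.add_apply, Pi.smul_apply, smul_eq_mul]; ring

lemma graphLine_zero (u₁ u₂ w₁ w₂ : V4) : graphLine u₁ u₂ w₁ w₂ 0 0 0 0 = span ℝ {u₁, u₂} := by
  simp [graphLine]

lemma graphLine_one (u₁ u₂ w₁ w₂ : V4) :
    graphLine u₁ u₂ w₁ w₂ 1 0 0 1 = span ℝ {u₁ + w₁, u₂ + w₂} := by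
  simp [graphLine]

lemma IsLine.eq_span {P : PLine} (hP : IsLine P) {x y : V4} (hx : x ∈ P) (hy : y ∈ P)
    (h : LinearIndependent ℝ ![x, y]) : P = span ℝ {x, y} := by
  refine (Submodule.eq_of_le_of_finrank_eq (span_le.2 ?_) ?_).symm
  · rintro z (rfl | rfl) <;> assumption
  · rw [hP]; exact isLine_span h

lemma Skew.exists_add_mem {P W : PLine} (h : Skew P W) (x : V4) : ∃ y ∈ W, x + y ∈ P := by
  have htop : P ⊔ W = ⊤ := by
    apply Submodule.eq_top_of_finrank_eq
    have := Submodule.finrank_sup_add_finrank_inf_eq P W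
    rw [h.2.2, finrank_bot, h.1, h.2.1] at this
    simpa using this
  obtain ⟨p, hp, w, hw, e⟩ := Submodule.mem_sup.1 (htop ▸ Submodule.mem_top : x ∈ P ⊔ W)
  exact ⟨-w, neg_mem hw, by rwa [← e, add_neg_cancel_right]⟩

lemma Skew.exists_graphLine {P : PLine} {u₁ u₂ w₁ w₂ : V4} (hd : det2 u₁ u₂ w₁ w₂ ≠ 0)
    (h : Skew P (span ℝ {w₁, w₂})) : ∃ a b c d : ℝ, P = graphLine u₁ u₂ w₁ w₂ a b c d := by
  obtain ⟨y₁, h₁, m₁⟩ := h.exists_add_mem u₁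
  obtain ⟨y₂, h₂, m₂⟩ := h.exists_add_mem u₂
  obtain ⟨a, c, rfl⟩ := Submodule.mem_span_pair.1 h₁
  obtain ⟨b, d, rfl⟩ := Submodule.mem_span_pair.1 h₂
  rw [← add_assoc] at m₁ m₂
  exact ⟨a, b, c, d, h.1.eq_span m₁ m₂ (linearIndependent_pair (c := w₁) (d := w₂)
    (by rwa [det2_swap, det2_graph]))⟩

/-- Three pairwise skew lines in normal form. -/
lemma exists_normal_frame {W U V : PLine} (hUW : Skew U W) (hVW : Skew V W) (hUV : Skew U V) :
    ∃ u₁ u₂ w₁ w₂ : V4, det2 u₁ u₂ w₁ w₂ ≠ 0 ∧ W = span ℝ {w₁, w₂} ∧ U = span ℝ {u₁, u₂} ∧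
      V = span ℝ {u₁ + w₁, u₂ + w₂} := by
  obtain ⟨u₁, u₂, rfl, -⟩ := exists_span_of_isLine hUW.1
  obtain ⟨z₁, z₂, rfl, -⟩ := exists_span_of_isLine hUW.2.1
  obtain ⟨a, b, c, d, rfl⟩ := hVW.exists_graphLine (det2_ne_zero_of_skew hUW)
  have hd : a * d - c * b ≠ 0 := by
    rw [← graphLine_zero u₁ u₂ z₁ z₂] at hUV
    have := left_ne_zero_of_mul (det2_graph_graph .. ▸ det2_ne_zero_of_skew hUV)
    intro h
    apply this
    linarith
  refine ⟨u₁, u₂, a • z₁ + c • z₂, b • z₁ + d • z₂, ?_, (span_comb_eq hd).symm, rfl, ?_⟩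
  · rw [← det2_swap, det2_comb_left, det2_swap]
    exact mul_ne_zero hd (det2_ne_zero_of_skew hUW)
  · simp only [graphLine, add_assoc]

/-- Linking index of two graphs and the line at infinity. -/
lemma lk_graphLine {u₁ u₂ w₁ w₂ : V4} (hd : det2 u₁ u₂ w₁ w₂ ≠ 0) (a b c d a' b' c' d' : ℝ) :
    lk (span ℝ {w₁, w₂}) (graphLine u₁ u₂ w₁ w₂ a b c d) (graphLine u₁ u₂ w₁ w₂ a' b' c' d') =
      SignType.sign (det2 u₁ u₂ w₁ w₂) *
        SignType.sign ((a - a') * (d - d') - (b - b') * (c - c')) := by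
  rw [graphLine, graphLine, lk_eq (by rwa [det2_graph]) (by rwa [det2_graph]), det2_graph,
    det2_graph, det2_graph_graph, sign_mul, sign_mul, sign_mul]
  rcases hd.lt_or_gt with h | h <;> simp [h]

lemma mul_pos_of_lk_graphLine_eq {u₁ u₂ w₁ w₂ : V4} (hd : det2 u₁ u₂ w₁ w₂ ≠ 0)
    {a b c d a' b' c' d' δ : ℝ} (hδ : δ ≠ 0)
    (h₀ : lk (span ℝ {w₁, w₂}) (span ℝ {u₁, u₂}) (span ℝ {u₁ + w₁, u₂ + w₂}) = δ) {ε : ℝ}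
    (h : lk (span ℝ {w₁, w₂}) (graphLine u₁ u₂ w₁ w₂ a b c d)
      (graphLine u₁ u₂ w₁ w₂ a' b' c' d') = ε * δ) (hε : ε ≠ 0) :
    0 < ε * ((a - a') * (d - d') - (b - b') * (c - c')) := by
  rw [← graphLine_zero u₁ u₂ w₁ w₂, ← graphLine_one, lk_graphLine hd] at h₀
  rw [lk_graphLine hd] at h
  have e1 : (0 - 1 : ℝ) * (0 - 1) - (0 - 0) * (0 - 0) = 1 := by norm_num
  rw [e1, sign_one, SignType.coe_one, mul_one] at h₀
  rw [h₀, mul_comm] at h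
  have h1 := mul_right_cancel₀ hδ h
  generalize (a - a') * (d - d') - (b - b') * (c - c') = q at *
  rw [← h1] at hε ⊢
  rcases lt_trichotomy q 0 with hq | rfl | hq
  · simp [hq]
  · simp at hε
  · simp [hq]

/-- A real `2 × 2` matrix with positive discriminant has two distinct real eigenvalues. -/
lemma exists_eigenvalues {a b c d : ℝ} (h : 0 < (a - d) ^ 2 + 4 * (b * c)) :
    ∃ l m : ℝ, l < m ∧ l + m = a + d ∧ l * m = a * d - b * c := by
  have hs := Real.sqrt_pos.2 h
  have hq := Real.sq_sqrt h.le
  refine ⟨(a + d - √((a - d) ^ 2 + 4 * (b * c))) / 2, (a + d + √((a - d) ^ 2 + 4 * (b * c))) / 2,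
    by linarith, by ring, by linear_combination -hq / 4⟩

lemma exists_eigenvectors {a b c d l m : ℝ} (hlm : l ≠ m) (hs : l + m = a + d)
    (hp : l * m = a * d - b * c) :
    ∃ p q r s : ℝ, p * s - q * r ≠ 0 ∧ a * p + b * q = l * p ∧ c * p + d * q = l * q ∧
      a * r + b * s = m * r ∧ c * r + d * s = m * s := by
  obtain rfl : d = l + m - a := by linarith
  by_cases hb : b = 0
  · subst hb
    rcases mul_eq_zero.1 (show (l - a) * (m - a) = 0 by linear_combination hp) with h | h
    · obtain rfl : l = a := by linarith
      exact ⟨l - m, c, 0, 1, by simpa [sub_eq_zero] using hlm, by ring, by ring, by ring, by ring⟩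
    · obtain rfl : m = a := by linarith
      exact ⟨0, 1, m - l, c, by simpa [sub_eq_zero] using hlm, by ring, by ring, by ring,
        by ring⟩
  · refine ⟨b, l - a, b, m - a, ?_, by ring, by linear_combination hp, by ring,
      by linear_combination hp⟩
    rw [show b * (m - a) - (l - a) * b = b * (m - l) by ring]
    exact mul_ne_zero hb (sub_ne_zero.2 hlm.symm)

/-- Base change bringing the graph of a diagonalizable matrix to diagonal form. -/
lemma graphLine_eq_diagonal (u₁ u₂ w₁ w₂ : V4) {a b c d l m p q r s : ℝ}
    (h : p * s - q * r ≠ 0) (h₁ : a * p + b * q = l * p) (h₂ : c * p + d * q = l * q)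
    (h₃ : a * r + b * s = m * r) (h₄ : c * r + d * s = m * s) :
    graphLine u₁ u₂ w₁ w₂ a b c d = graphLine (p • u₁ + q • u₂) (r • u₁ + s • u₂)
      (p • w₁ + q • w₂) (r • w₁ + s • w₂) l 0 0 m := by
  rw [graphLine, graphLine, ← span_comb_eq h]
  congr 2
  · ext i
    simp only [Pi.add_apply, Pi.smul_apply, smul_eq_mul]
    linear_combination h₁ * w₁ i + h₂ * w₂ i
  · congr 1
    ext i
    simp only [Pi.add_apply, Pi.smul_apply, smul_eq_mul]
    linear_combination h₃ * w₁ i + h₄ * w₂ i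

lemma SymmTrilinear.offDiagonal_eq_zero (T : SymmTrilinear) (hT : ∀ p, p ≠ 0 → ∃ y, T.toFun p p y ≠ 0)
    {u₁ u₂ w₁ w₂ : V4} (hd : det2 u₁ u₂ w₁ w₂ ≠ 0)
    (hu : ∀ x ∈ span ℝ {u₁, u₂}, T.toFun x x x = 0)
    (hw : ∀ x ∈ span ℝ {w₁, w₂}, T.toFun x x x = 0)
    (huw : ∀ x ∈ span ℝ {u₁ + w₁, u₂ + w₂}, T.toFun x x x = 0)
    {α β a b c d : ℝ} (h₃ : ∀ x ∈ graphLine u₁ u₂ w₁ w₂ α 0 0 β, T.toFun x x x = 0)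
    (hα0 : α ≠ 0) (hα1 : α ≠ 1) (hβ0 : β ≠ 0) (hβ1 : β ≠ 1)
    (h : ∀ x ∈ graphLine u₁ u₂ w₁ w₂ a b c d, T.toFun x x x = 0)
    (h0 : a * d - b * c ≠ 0) (h1 : (a - 1) * (d - 1) - b * c ≠ 0)
    (hdisc : 0 < (a - d) ^ 2 + 4 * (b * c)) : b * c = 0 := by
  by_contra hbc
  obtain ⟨l, m, hlm, hs, hp⟩ := exists_eigenvalues hdisc
  have hb := left_ne_zero_of_mul hbc
  have hroot : ∀ x : ℝ, (x = l ∨ x = m) → x ^ 2 = (a + d) * x - (a * d - b * c) := by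
    rintro x (rfl | rfl) <;> rw [← hs, ← hp] <;> ring
  have hx0 : ∀ x : ℝ, (x = l ∨ x = m) → x ≠ 0 := by
    rintro x hx rfl
    exact h0 (by linarith [hroot 0 hx])
  have hx1 : ∀ x : ℝ, (x = l ∨ x = m) → x ≠ 1 := by
    rintro x hx rfl
    exact h1 (by linarith [hroot 1 hx])
  have hxa : ∀ x : ℝ, (x = l ∨ x = m) → (x - a) / b ≠ 0 := by
    intro x hx
    refine div_ne_zero (fun e => hbc ?_) hb
    obtain rfl : x = a := by linarith
    linarith [hroot x hx]
  have hpt : ∀ x : ℝ, (x = l ∨ x = m) →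
      (u₁ + ((x - a) / b) • u₂) + x • (w₁ + ((x - a) / b) • w₂) ∈
        graphLine u₁ u₂ w₁ w₂ a b c d := by
    intro x hx
    refine Submodule.mem_span_pair.2 ⟨1, (x - a) / b, ?_⟩
    have e1 : a + (x - a) / b * b = x := by rw [div_mul_cancel₀ _ hb]; ring
    have e2 : c + (x - a) / b * d = x * ((x - a) / b) := by
      field_simp
      linarith [hroot x hx]
    ext i
    simp only [Pi.add_apply, Pi.smul_apply, smul_eq_mul]
    linear_combination e1 * w₁ i + e2 * w₂ i
  obtain ⟨p, hp0, hp⟩ := T.exists_singular hd hu hw huw (m := (l - a) / b) (n := (m - a) / b)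
    (fun e => hlm.ne (by
      have := (div_left_inj' hb).1 e
      linarith)) (hxa l (.inl rfl)) (hxa m (.inr rfl)) hα0 hα1 hβ0 hβ1
    (hx0 l (.inl rfl)) (hx1 l (.inl rfl)) (hx0 m (.inr rfl)) (hx1 m (.inr rfl))
    (h₃ _ (Submodule.mem_span_pair.2 ⟨1, 0, by simp⟩))
    (h₃ _ (Submodule.mem_span_pair.2 ⟨0, 1, by simp⟩))
    (h _ (hpt l (.inl rfl))) (h _ (hpt m (.inr rfl)))
  obtain ⟨y, hy⟩ := hT p hp0
  exact hy (hp y)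

/-- Six lines: the span of `w₁, w₂` and five graphs. -/
def normalConfig (u₁ u₂ w₁ w₂ : V4) (a b c d : Fin 5 → ℝ) : Fin 6 → PLine :=
  Fin.cons (span ℝ {w₁, w₂}) fun i => graphLine u₁ u₂ w₁ w₂ (a i) (b i) (c i) (d i)

lemma pairwiseSkew_normalConfig {u₁ u₂ w₁ w₂ : V4} (hd : det2 u₁ u₂ w₁ w₂ ≠ 0)
    {a b c d : Fin 5 → ℝ}
    (h : ∀ i j, i < j → (a i - a j) * (d i - d j) - (b i - b j) * (c i - c j) ≠ 0) :
    PairwiseSkew (normalConfig u₁ u₂ w₁ w₂ a b c d) := by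
  intro i j hij
  induction i using Fin.cases with
  | zero =>
    induction j using Fin.cases with
    | zero => exact absurd rfl hij
    | succ j =>
      simp only [normalConfig, Fin.cons_zero, Fin.cons_succ]
      exact skew_of_det2_ne_zero (by rwa [det2_graph])
  | succ i =>
    induction j using Fin.cases with
    | zero =>
      simp only [normalConfig, Fin.cons_zero, Fin.cons_succ]
      exact skew_of_det2_ne_zero (by rwa [det2_swap, det2_graph])
    | succ j =>
      simp only [normalConfig, Fin.cons_succ]
      refine skew_of_det2_ne_zero ?_
      rw [det2_graph_graph]
      refine mul_ne_zero ?_ hd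
      rcases (ne_of_apply_ne Fin.succ hij).lt_or_gt with hlt | hlt
      · exact h i j hlt
      · convert h j i hlt using 1; ring

lemma deformation_normalConfig {u₁ u₂ w₁ w₂ : V4} (hd : det2 u₁ u₂ w₁ w₂ ≠ 0)
    {a b c d : ℝ → Fin 5 → ℝ} (ha : Continuous a) (hb : Continuous b) (hc : Continuous c)
    (hd' : Continuous d)
    (h : ∀ t ∈ Set.Icc (0 : ℝ) 1, ∀ i j, i < j →
      (a t i - a t j) * (d t i - d t j) - (b t i - b t j) * (c t i - c t j) ≠ 0) :
    Deformation (normalConfig u₁ u₂ w₁ w₂ (a 0) (b 0) (c 0) (d 0))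
      (normalConfig u₁ u₂ w₁ w₂ (a 1) (b 1) (c 1) (d 1)) := by
  refine ⟨fun t => normalConfig u₁ u₂ w₁ w₂ (a t) (b t) (c t) (d t), fun i => ?_,
    fun t ht => pairwiseSkew_normalConfig hd (h t ht), rfl, rfl⟩
  induction i using Fin.cases with
  | zero => exact ⟨fun _ => w₁, fun _ => w₂, continuousOn_const, continuousOn_const,
      fun t _ => rfl⟩
  | succ i =>
    refine ⟨fun t => u₁ + a t i • w₁ + c t i • w₂, fun t => u₂ + b t i • w₁ + d t i • w₂, ?_, ?_,
      fun t _ => rfl⟩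
    · exact Continuous.continuousOn (by fun_prop)
    · exact Continuous.continuousOn (by fun_prop)

/-- Diagonal configurations with equally ordered entries are deformation equivalent. -/
lemma deformation_diagonal {u₁ u₂ w₁ w₂ : V4} (hd : det2 u₁ u₂ w₁ w₂ ≠ 0)
    {a d a' d' : Fin 5 → ℝ} {p q : Fin 5 → Fin 5} (hp : Function.Surjective p)
    (hq : Function.Surjective q) (ha : StrictMono (a ∘ p)) (ha' : StrictMono (a' ∘ p))
    (hdq : StrictMono (d ∘ q)) (hdq' : StrictMono (d' ∘ q)) :
    Deformation (normalConfig u₁ u₂ w₁ w₂ a 0 0 d) (normalConfig u₁ u₂ w₁ w₂ a' 0 0 d') := by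
  have key : ∀ {x x' : Fin 5 → ℝ} {f : Fin 5 → Fin 5}, Function.Surjective f → StrictMono (x ∘ f) →
      StrictMono (x' ∘ f) → ∀ t ∈ Set.Icc (0 : ℝ) 1, ∀ i j, i ≠ j →
      ((1 - t) * x i + t * x' i) - ((1 - t) * x j + t * x' j) ≠ 0 := by
    rintro x x' f hf hx hx' t ⟨ht0, ht1⟩ i j hij
    have hmono : StrictMono fun i => (1 - t) * x (f i) + t * x' (f i) := by
      intro i j hij
      have h1 : x (f i) < x (f j) := hx hij
      have h2 : x' (f i) < x' (f j) := hx' hij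
      dsimp only
      rcases ht1.eq_or_lt with rfl | ht1
      · linarith
      · nlinarith
    obtain ⟨i, rfl⟩ := hf i
    obtain ⟨j, rfl⟩ := hf j
    exact sub_ne_zero.2 fun e => hij (congrArg f (hmono.injective e))
  have := deformation_normalConfig hd (a := fun t i => (1 - t) * a i + t * a' i) (b := fun _ => 0)
    (c := fun _ => 0) (d := fun t i => (1 - t) * d i + t * d' i) (by fun_prop) (by fun_prop)
    (by fun_prop) (by fun_prop) (fun t ht i j hij => by
      simpa using ⟨key hp ha ha' t ht i j hij.ne, key hq hdq hdq' t ht i j hij.ne⟩)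
  simpa using this

/-- The join configuration, with its line of index `ρ 0` moved to infinity in both factors. -/
lemma exists_map_joinConfig {u₁ u₂ w₁ w₂ : V4} (hd : det2 u₁ u₂ w₁ w₂ ≠ 0)
    (σ ρ : Equiv.Perm (Fin 6)) : ∃ M : V4 →ₗ[ℝ] V4, LinearMap.det M ≠ 0 ∧
      (fun i => (joinConfig σ (ρ i)).map M) = normalConfig u₁ u₂ w₁ w₂
        (fun i => (((ρ 0).val : ℝ) - (ρ i.succ).val)⁻¹) 0 0
        (fun i => (((σ (ρ 0)).val : ℝ) - (σ (ρ i.succ)).val)⁻¹) := by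
  set α : ℝ := ((ρ 0).val : ℝ) + 1 with hα
  set β : ℝ := ((σ (ρ 0)).val : ℝ) + 1 with hβ
  let M : V4 →ₗ[ℝ] V4 :=
    { toFun := fun y => (α * y 0 - y 1) • u₁ + (β * y 3 - y 2) • u₂ + y 0 • w₁ + y 3 • w₂
      map_add' := fun x y => by
        ext i; simp only [Pi.add_apply, Pi.smul_apply, smul_eq_mul]; ring
      map_smul' := fun c y => by
        ext i; simp only [Pi.add_apply, Pi.smul_apply, smul_eq_mul, RingHom.id_apply]; ring }
  have hM : ∀ y, M y = (α * y 0 - y 1) • u₁ + (β * y 3 - y 2) • u₂ + y 0 • w₁ + y 3 • w₂ :=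
    fun _ => rfl
  have hline (i : Fin 6) : (joinConfig σ i).map M =
      span ℝ {(α - (i.val + 1)) • u₁ + w₁, (β - ((σ i).val + 1)) • u₂ + w₂} := by
    rw [joinConfig, Submodule.map_span, Set.image_pair, hM, hM]
    simp
  refine ⟨M, fun h0 => ?_, ?_⟩
  · have h1 := det2_map M (Pi.single 0 1) (Pi.single 1 1) (Pi.single 2 1) (Pi.single 3 1)
    rw [h0, zero_mul] at h1
    simp only [hM] at h1
    refine hd ?_
    simp [det2_apply] at h1
    rw [det2_apply]
    linarith
  · funext i
    rw [hline]
    induction i using Fin.cases with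
    | zero => simp [normalConfig, hα, hβ]
    | succ i =>
      have h1 : ((ρ 0).val : ℝ) - (ρ i.succ).val ≠ 0 := by
        rw [sub_ne_zero]
        exact_mod_cast fun e => (Fin.succ_ne_zero i).symm (ρ.injective (Fin.ext e))
      have h2 : ((σ (ρ 0)).val : ℝ) - (σ (ρ i.succ)).val ≠ 0 := by
        rw [sub_ne_zero]
        exact_mod_cast fun e => (Fin.succ_ne_zero i).symm (ρ.injective (σ.injective (Fin.ext e)))
      refine Eq.trans ?_ (span_comb_eq (p := ((ρ 0).val : ℝ) - (ρ i.succ).val) (q := 0) (r := 0)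
        (s := ((σ (ρ 0)).val : ℝ) - (σ (ρ i.succ)).val) (by simpa using ⟨h1, h2⟩))
      congr 2
      · simp [smul_smul, h1, hα]
      · simp [smul_smul, h2, hβ]

/-- Removing the off-diagonal entries while moving the diagonal ones linearly. -/
lemma deformation_diagonalize {u₁ u₂ w₁ w₂ : V4} (hd : det2 u₁ u₂ w₁ w₂ ≠ 0)
    {a b c d : Fin 5 → ℝ} (x y : Fin 5 → ℝ)
    (h : ∀ t ∈ Set.Icc (0 : ℝ) 1, ∀ i j, i < j →
      (a i - a j + t * (x i - x j)) * (d i - d j + t * (y i - y j)) -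
        (1 - t) ^ 2 * ((b i - b j) * (c i - c j)) ≠ 0) :
    Deformation (normalConfig u₁ u₂ w₁ w₂ a b c d)
      (normalConfig u₁ u₂ w₁ w₂ (a + x) 0 0 (d + y)) := by
  have := deformation_normalConfig hd (a := fun t => a + t • x) (b := fun t => (1 - t) • b)
    (c := fun t => (1 - t) • c) (d := fun t => d + t • y) (by fun_prop) (by fun_prop)
    (by fun_prop) (by fun_prop) (fun t ht i j hij => by
      convert h t ht i j hij using 1
      simp only [Pi.add_apply, Pi.smul_apply, smul_eq_mul]
      ring)
  simpa using this

lemma sub_sub_neg {P X t : ℝ} (h : P - X < 0) (ht0 : 0 ≤ t) (ht1 : t ≤ 1) :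
    P - t * (2 * |P| + 1) - (1 - t) ^ 2 * X < 0 := by
  have h1 := le_abs_self P
  have h2 := abs_nonneg P
  rcases ht0.eq_or_lt with rfl | ht
  · linarith
  · have e : P - t * (2 * |P| + 1) - (1 - t) ^ 2 * X =
        (1 - t) ^ 2 * (P - X) + t * (2 - t) * (P - |P|) - t ^ 2 * |P| - t := by ring
    have h3 : 0 ≤ (1 - t) ^ 2 * (X - P) := mul_nonneg (sq_nonneg _) (by linarith)
    have h4 : 0 ≤ t * (2 - t) * (|P| - P) :=
      mul_nonneg (mul_nonneg ht0 (by linarith)) (by linarith)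
    have h5 : 0 ≤ t ^ 2 * |P| := by positivity
    rw [e]
    linarith

/-- The possible orders of the diagonal entries. -/
def Chambers (a₃ d₃ a₄ d₄ a₅ d₅ : ℝ) : Prop :=
  a₃ < 0 ∧ 0 < d₃ ∧ d₃ < 1 ∧ d₃ < d₅ ∧ (0 < a₅ ∧ a₅ < 1 ∧ 1 < d₅ ∨ 1 < a₅ ∧ d₅ < 1) ∧
    (a₄ < a₃ ∧ 1 < d₄ ∧ d₅ < d₄ ∨ d₄ < 0 ∧ 1 < a₄ ∧ a₅ < a₄)

lemma exists_deformation_chambers {u₁ u₂ w₁ w₂ : V4} (hd : det2 u₁ u₂ w₁ w₂ ≠ 0)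
    {a₃ d₃ a₄ b₄ c₄ d₄ a₅ b₅ c₅ d₅ : ℝ} (ha₃ : a₃ < 0) (hd₃ : 0 < d₃) (hd₃' : d₃ < 1)
    (h₄ : b₄ * c₄ = 0) (h₅ : b₅ * c₅ = 0) (h04 : a₄ * d₄ < 0) (h14 : (a₄ - 1) * (d₄ - 1) < 0)
    (h05 : 0 < a₅ * d₅) (h15 : (a₅ - 1) * (d₅ - 1) < 0) (h34 : (a₃ - a₄) * (d₃ - d₄) < 0)
    (h35 : 0 < (a₃ - a₅) * (d₃ - d₅))
    (h45 : (a₄ - a₅) * (d₄ - d₅) - (b₄ - b₅) * (c₄ - c₅) < 0) :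
    ∃ a₄' d₄' : ℝ, Chambers a₃ d₃ a₄' d₄' a₅ d₅ ∧
      Deformation (normalConfig u₁ u₂ w₁ w₂ ![0, 1, a₃, a₄, a₅] ![0, 0, 0, b₄, b₅]
          ![0, 0, 0, c₄, c₅] ![0, 1, d₃, d₄, d₅])
        (normalConfig u₁ u₂ w₁ w₂ ![0, 1, a₃, a₄', a₅] 0 0 ![0, 1, d₃, d₄', d₅]) := by
  have motion : ∀ x y : ℝ, (∀ t ∈ Set.Icc (0 : ℝ) 1,
      (a₄ + t * x) * (d₄ + t * y) ≠ 0 ∧ (1 - (a₄ + t * x)) * (1 - (d₄ + t * y)) ≠ 0 ∧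
      (a₃ - (a₄ + t * x)) * (d₃ - (d₄ + t * y)) ≠ 0 ∧
      (a₄ + t * x - a₅) * (d₄ + t * y - d₅) - (1 - t) ^ 2 * ((b₄ - b₅) * (c₄ - c₅)) ≠ 0) →
      Deformation (normalConfig u₁ u₂ w₁ w₂ ![0, 1, a₃, a₄, a₅] ![0, 0, 0, b₄, b₅]
          ![0, 0, 0, c₄, c₅] ![0, 1, d₃, d₄, d₅])
        (normalConfig u₁ u₂ w₁ w₂ ![0, 1, a₃, a₄ + x, a₅] 0 0 ![0, 1, d₃, d₄ + y, d₅]) := by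
    intro x y h
    convert deformation_diagonalize hd ![0, 0, 0, x, 0] ![0, 0, 0, y, 0] ?_ using 2
    · simp
    · simp
    intro t ht i j hij
    obtain ⟨k1, k2, k3, k4⟩ := h t ht
    fin_cases i <;> fin_cases j <;> first | exact absurd hij (by decide) | skip
    all_goals simp [h₄, h₅]
    · exact ⟨ha₃.ne, hd₃.ne'⟩
    · refine mul_ne_zero_iff.1 fun e => k1 ?_
      linarith
    · exact mul_ne_zero_iff.1 h05.ne'
    · constructor <;> linarith
    · refine mul_ne_zero_iff.1 fun e => k2 ?_
      linarith
    · refine mul_ne_zero_iff.1 fun e => h15.ne ?_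
      linarith
    · refine mul_ne_zero_iff.1 fun e => k3 ?_
      linarith
    · exact mul_ne_zero_iff.1 h35.ne'
    · refine fun e => k4 ?_
      linarith
  set P := (a₄ - a₅) * (d₄ - d₅) with hP
  have hP0 := abs_nonneg P
  have hP1 := le_abs_self P
  have hpos5 : 0 < a₅ ∧ 0 < d₅ := by
    rcases pos_and_pos_or_neg_and_neg_of_mul_pos h05 with h | ⟨h1, h2⟩
    · exact h
    · exact absurd h15 (not_lt.2 (mul_nonneg_of_nonpos_of_nonpos (by linarith) (by linarith)))
  obtain ⟨ha5, hd5⟩ := hpos5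
  have hd35 : d₃ < d₅ := by
    by_contra! h
    exact absurd h35 (not_lt.2 (mul_nonpos_of_nonpos_of_nonneg (by linarith) (by linarith)))
  have h5 : 0 < a₅ ∧ a₅ < 1 ∧ 1 < d₅ ∨ 1 < a₅ ∧ d₅ < 1 := by
    rcases mul_neg_iff.1 h15 with ⟨h1, h2⟩ | ⟨h1, h2⟩
    · exact Or.inr ⟨by linarith, by linarith⟩
    · exact Or.inl ⟨ha5, by linarith, by linarith⟩
  rcases mul_neg_iff.1 h04 with ⟨ha4, hd4⟩ | ⟨ha4, hd4⟩
  · have ha4' : 1 < a₄ := by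
      by_contra! h
      exact absurd h14 (not_lt.2 (mul_nonneg_of_nonpos_of_nonpos (by linarith) (by linarith)))
    have hpos : 0 < d₅ - d₄ := by linarith
    have hx : 0 < (2 * |P| + 1) / (d₅ - d₄) := by positivity
    have hxP : (2 * |P| + 1) / (d₅ - d₄) * (d₅ - d₄) = 2 * |P| + 1 := div_mul_cancel₀ _ hpos.ne'
    generalize (2 * |P| + 1) / (d₅ - d₄) = x at hx hxP
    have h' : a₅ < a₄ + x := by
      by_contra! h
      have : 0 ≤ (a₅ - (a₄ + x)) * (d₅ - d₄) := mul_nonneg (by linarith) hpos.le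
      nlinarith
    refine ⟨a₄ + x, d₄, ⟨ha₃, hd₃, hd₃', hd35, h5, Or.inr ⟨hd4, by linarith, h'⟩⟩, ?_⟩
    convert motion x 0 ?_ using 2
    · simp
    rintro t ⟨ht0, ht1⟩
    have htx := mul_nonneg ht0 hx.le
    simp only [mul_zero, add_zero]
    refine ⟨mul_ne_zero (by linarith) hd4.ne, mul_ne_zero (by linarith) (by linarith),
      mul_ne_zero (by linarith) (by linarith), ne_of_lt ?_⟩
    refine lt_of_eq_of_lt ?_ (sub_sub_neg h45 ht0 ht1)
    linear_combination -t * hxP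
  · have hd4' : 1 < d₄ := by
      by_contra! h
      exact absurd h14 (not_lt.2 (mul_nonneg_of_nonpos_of_nonpos (by linarith) (by linarith)))
    have ha4' : a₄ < a₃ := by
      by_contra! h
      exact absurd h34 (not_lt.2 (mul_nonneg_of_nonpos_of_nonpos (by linarith) (by linarith)))
    have hpos : 0 < a₅ - a₄ := by linarith
    have hx : 0 < (2 * |P| + 1) / (a₅ - a₄) := by positivity
    have hxP : (2 * |P| + 1) / (a₅ - a₄) * (a₅ - a₄) = 2 * |P| + 1 := div_mul_cancel₀ _ hpos.ne'
    generalize (2 * |P| + 1) / (a₅ - a₄) = x at hx hxP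
    have h' : d₅ < d₄ + x := by
      by_contra! h
      have : 0 ≤ (a₅ - a₄) * (d₅ - (d₄ + x)) := mul_nonneg hpos.le (by linarith)
      nlinarith
    refine ⟨a₄, d₄ + x, ⟨ha₃, hd₃, hd₃', hd35, h5, Or.inl ⟨ha4', by linarith, h'⟩⟩, ?_⟩
    convert motion 0 x ?_ using 2
    · simp
    rintro t ⟨ht0, ht1⟩
    have htx := mul_nonneg ht0 hx.le
    simp only [mul_zero, add_zero]
    refine ⟨mul_ne_zero ha4.ne (by linarith), mul_ne_zero (by linarith) (by linarith),
      mul_ne_zero (by linarith) (by linarith), ne_of_lt ?_⟩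
    refine lt_of_eq_of_lt ?_ (sub_sub_neg h45 ht0 ht1)
    linear_combination -t * hxP

lemma strictMono_fin_five {f : Fin 5 → ℝ} (h₀ : f 0 < f 1) (h₁ : f 1 < f 2) (h₂ : f 2 < f 3)
    (h₃ : f 3 < f 4) : StrictMono f := by
  refine Fin.strictMono_iff_lt_succ.2 fun i => ?_
  fin_cases i <;> assumption

lemma Chambers.exists_deformation {a₃ d₃ a₄ d₄ a₅ d₅ : ℝ} (h : Chambers a₃ d₃ a₄ d₄ a₅ d₅)
    {u₁ u₂ w₁ w₂ : V4} (hd : det2 u₁ u₂ w₁ w₂ ≠ 0) :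
    ∃ (ρ : Equiv.Perm (Fin 6)) (M : V4 →ₗ[ℝ] V4), LinearMap.det M ≠ 0 ∧
      Deformation (normalConfig u₁ u₂ w₁ w₂ ![0, 1, a₃, a₄, a₅] 0 0 ![0, 1, d₃, d₄, d₅])
        (fun i => (joinConfig (Equiv.swap (0 : Fin 6) 1 * Equiv.swap (2 : Fin 6) 3 *
          Equiv.swap (4 : Fin 6) 5) (ρ i)).map M) := by
  set σ : Equiv.Perm (Fin 6) := Equiv.swap 0 1 * Equiv.swap 2 3 * Equiv.swap 4 5 with hσ
  have hσv : ∀ i, σ i = ![1, 0, 3, 2, 5, 4] i := by decide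
  have main : ∀ (ρ : Equiv.Perm (Fin 6)) (p q : Fin 5 → Fin 5), Function.Surjective p →
      Function.Surjective q → StrictMono (![0, 1, a₃, a₄, a₅] ∘ p) →
      StrictMono ((fun i : Fin 5 => (((ρ 0).val : ℝ) - (ρ i.succ).val)⁻¹) ∘ p) →
      StrictMono (![0, 1, d₃, d₄, d₅] ∘ q) →
      StrictMono ((fun i : Fin 5 => (((σ (ρ 0)).val : ℝ) - (σ (ρ i.succ)).val)⁻¹) ∘ q) →
      ∃ (ρ : Equiv.Perm (Fin 6)) (M : V4 →ₗ[ℝ] V4), LinearMap.det M ≠ 0 ∧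
        Deformation (normalConfig u₁ u₂ w₁ w₂ ![0, 1, a₃, a₄, a₅] 0 0 ![0, 1, d₃, d₄, d₅])
          (fun i => (joinConfig σ (ρ i)).map M) := by
    intro ρ p q hp hq h1 h2 h3 h4
    obtain ⟨M, hM, e⟩ := exists_map_joinConfig hd σ ρ
    exact ⟨ρ, M, hM, e ▸ deformation_diagonal hd hp hq h1 h2 h3 h4⟩
  obtain ⟨ha₃, hd₃, hd₃', hd35, ⟨h1, h2, h3⟩ | ⟨h1, h2⟩, ⟨h4, h5, h6⟩ | ⟨h4, h5, h6⟩⟩ := h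
  · refine main ⟨![4, 1, 3, 0, 5, 2], ![3, 1, 5, 2, 0, 4], by decide, by decide⟩
      ![3, 2, 0, 4, 1] ![0, 2, 1, 4, 3] (by decide) (by decide) ?_ ?_ ?_ ?_ <;>
    · refine strictMono_fin_five ?_ ?_ ?_ ?_ <;> simp [hσv] <;> norm_num <;> linarith
  · refine main ⟨![5, 1, 3, 0, 4, 2], ![3, 1, 5, 2, 4, 0], by decide, by decide⟩
      ![2, 0, 4, 1, 3] ![3, 0, 2, 1, 4] (by decide) (by decide) ?_ ?_ ?_ ?_ <;>
    · refine strictMono_fin_five ?_ ?_ ?_ ?_ <;> simp [hσv] <;> norm_num <;> linarith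
  · refine main ⟨![4, 1, 2, 0, 5, 3], ![3, 1, 2, 5, 0, 4], by decide, by decide⟩
      ![3, 2, 0, 1, 4] ![0, 2, 4, 1, 3] (by decide) (by decide) ?_ ?_ ?_ ?_ <;>
    · refine strictMono_fin_five ?_ ?_ ?_ ?_ <;> simp [hσv] <;> norm_num <;> linarith
  · refine main ⟨![5, 1, 2, 0, 4, 3], ![3, 1, 2, 5, 4, 0], by decide, by decide⟩
      ![2, 0, 1, 4, 3] ![3, 0, 2, 4, 1] (by decide) (by decide) ?_ ?_ ?_ ?_ <;>
    · refine strictMono_fin_five ?_ ?_ ?_ ?_ <;> simp [hσv] <;> norm_num <;> linarith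

/-- Four lines with linking indices as in the tripartite pattern, in diagonal form. -/
lemma exists_diagonal_frame {W U V P : PLine} (hUW : Skew U W) (hVW : Skew V W) (hUV : Skew U V)
    (hPW : Skew P W) {δ : ℝ} (hδ : δ ≠ 0) (h : lk W U V = δ) (hUP : lk W U P = -δ)
    (hVP : lk W V P = δ) :
    ∃ (u₁ u₂ w₁ w₂ : V4) (a d : ℝ), det2 u₁ u₂ w₁ w₂ ≠ 0 ∧ W = span ℝ {w₁, w₂} ∧
      U = span ℝ {u₁, u₂} ∧ V = span ℝ {u₁ + w₁, u₂ + w₂} ∧ P = graphLine u₁ u₂ w₁ w₂ a 0 0 d ∧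
      a < 0 ∧ 0 < d ∧ d < 1 := by
  obtain ⟨u₁, u₂, w₁, w₂, hd, rfl, rfl, rfl⟩ := exists_normal_frame hUW hVW hUV
  obtain ⟨a, b, c, d, rfl⟩ := hPW.exists_graphLine hd
  rw [← graphLine_zero u₁ u₂ w₁ w₂] at hUP
  rw [← graphLine_one u₁ u₂ w₁ w₂] at hVP
  have h0 := mul_pos_of_lk_graphLine_eq hd hδ h (hUP.trans (neg_one_mul δ).symm) (by norm_num)
  have h1 := mul_pos_of_lk_graphLine_eq hd hδ h (hVP.trans (one_mul δ).symm) (by norm_num)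
  obtain ⟨l, m, hlm, hs, hm⟩ := exists_eigenvalues (a := a) (b := b) (c := c) (d := d)
    (by nlinarith [sq_nonneg (a + d)])
  obtain ⟨p, q, r, s, hdet, e₁, e₂, e₃, e₄⟩ := exists_eigenvectors hlm.ne hs hm
  have hlm0 : l * m < 0 := by linarith
  have hlm1 : 0 < (1 - l) * (1 - m) := by linarith
  have hl : l < 0 := by
    by_contra! hl
    exact absurd hlm0 (not_lt.2 (mul_nonneg hl (hl.trans hlm.le)))
  refine ⟨p • u₁ + q • u₂, r • u₁ + s • u₂, p • w₁ + q • w₂, r • w₁ + s • w₂, l, m, ?_,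
    (span_comb_eq hdet).symm, (span_comb_eq hdet).symm, ?_,
    graphLine_eq_diagonal u₁ u₂ w₁ w₂ hdet e₁ e₂ e₃ e₄, hl, pos_of_mul_neg_right hlm0 hl.le, ?_⟩
  · rw [det2_comb_left, det2_swap, det2_comb_left, det2_swap]
    exact mul_ne_zero hdet (mul_ne_zero hdet hd)
  · rw [← span_comb_eq hdet]
    congr 2
    · module
    · congr 1
      module
  · linarith [pos_of_mul_pos_right hlm1 (by linarith : 0 ≤ 1 - l)]

lemma normalConfig_eq {K : Fin 6 → PLine} {u₁ u₂ w₁ w₂ : V4}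
    {a₃ d₃ a₄ b₄ c₄ d₄ a₅ b₅ c₅ d₅ : ℝ} (h₀ : K 0 = span ℝ {w₁, w₂}) (h₁ : K 1 = span ℝ {u₁, u₂})
    (h₂ : K 2 = span ℝ {u₁ + w₁, u₂ + w₂}) (h₃ : K 3 = graphLine u₁ u₂ w₁ w₂ a₃ 0 0 d₃)
    (h₄ : K 4 = graphLine u₁ u₂ w₁ w₂ a₄ b₄ c₄ d₄) (h₅ : K 5 = graphLine u₁ u₂ w₁ w₂ a₅ b₅ c₅ d₅) :
    K = normalConfig u₁ u₂ w₁ w₂ ![0, 1, a₃, a₄, a₅] ![0, 0, 0, b₄, b₅] ![0, 0, 0, c₄, c₅]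
      ![0, 1, d₃, d₄, d₅] := by
  rw [← graphLine_zero u₁ u₂ w₁ w₂] at h₁
  rw [← graphLine_one u₁ u₂ w₁ w₂] at h₂
  funext i
  fin_cases i <;> assumption

lemma PairwiseSkew.isLine {n : ℕ} [Nontrivial (Fin n)] {L : Fin n → PLine} (h : PairwiseSkew L)
    (i : Fin n) : IsLine (L i) := by
  obtain ⟨j, hj⟩ := exists_ne i
  exact (h i j hj.symm).1

lemma Deformation.isLine_right {n : ℕ} [Nontrivial (Fin n)] {L L' : Fin n → PLine}
    (h : Deformation L L') (i : Fin n) : IsLine (L' i) := by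
  obtain ⟨F, -, hF, -, rfl⟩ := h
  exact (hF 1 (by simp)).isLine i

lemma pairwiseSkew_joinConfig {n : ℕ} (σ : Equiv.Perm (Fin n)) : PairwiseSkew (joinConfig σ) := by
  intro i j hij
  refine skew_of_det2_ne_zero ?_
  have h1 : (j.val : ℝ) - i.val ≠ 0 := by
    rw [sub_ne_zero]
    exact_mod_cast fun e : j.val = i.val => hij (Fin.ext e.symm)
  have h2 : ((σ i).val : ℝ) - (σ j).val ≠ 0 := by
    rw [sub_ne_zero]
    exact_mod_cast fun e => hij (σ.injective (Fin.ext e))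
  have := mul_ne_zero h1 h2
  contrapose! this
  rw [← neg_eq_zero, ← this]
  simp [det2_apply]
  ring

theorem schlafli_tripartite_coarse_J214365 (L : Fin 6 → PLine) (hL : IsSchlafliSix L)
    (hsig : ∀ i : Fin 6, |sgnOf (L ∘ i.succAbove)| = 2) :
    CoarseDeformEquiv L
      (joinConfig (Equiv.swap (0 : Fin 6) 1 * Equiv.swap (2 : Fin 6) 3 * Equiv.swap (4 : Fin 6) 5)) := by
  obtain ⟨T, hTL, hT⟩ := hL.exists_symmTrilinear
  obtain ⟨π, δ, hδ, h12, h13, h23, h14, h24, h15, h25, h34, h35, h45⟩ := hL.1.exists_pattern hsig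
  have hδ0 : δ ≠ 0 := by rcases hδ with rfl | rfl <;> norm_num
  have hskew : ∀ i j, i ≠ j → Skew (L (π i)) (L (π j)) := fun i j hij =>
    hL.1 _ _ (π.injective.ne hij)
  have hTK : ∀ i, ∀ x ∈ L (π i), T.toFun x x x = 0 := fun i => hTL (π i)
  obtain ⟨u₁, u₂, w₁, w₂, a₃, d₃, hd, k0, k1, k2, k3, ha₃, hd₃, hd₃'⟩ :=
    exists_diagonal_frame (hskew 1 0 (by decide)) (hskew 2 0 (by decide)) (hskew 1 2 (by decide))
      (hskew 3 0 (by decide)) hδ0 h12 h13 h23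
  obtain ⟨a₄, b₄, c₄, d₄, k4⟩ := (k0 ▸ hskew 4 0 (by decide)).exists_graphLine hd
  obtain ⟨a₅, b₅, c₅, d₅, k5⟩ := (k0 ▸ hskew 5 0 (by decide)).exists_graphLine hd
  rw [k0, k1, k2] at h12
  rw [k0, k1, k4, ← graphLine_zero u₁ u₂ w₁ w₂] at h14
  rw [k0, k1, k5, ← graphLine_zero u₁ u₂ w₁ w₂] at h15
  rw [k0, k2, k4, ← graphLine_one u₁ u₂ w₁ w₂] at h24
  rw [k0, k2, k5, ← graphLine_one u₁ u₂ w₁ w₂] at h25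
  rw [k0, k3, k4] at h34
  rw [k0, k3, k5] at h35
  rw [k0, k4, k5] at h45
  have s14 := mul_pos_of_lk_graphLine_eq hd hδ0 h12 (h14.trans (neg_one_mul δ).symm) (by norm_num)
  have s24 := mul_pos_of_lk_graphLine_eq hd hδ0 h12 (h24.trans (neg_one_mul δ).symm) (by norm_num)
  have s15 := mul_pos_of_lk_graphLine_eq hd hδ0 h12 (h15.trans (one_mul δ).symm) (by norm_num)
  have s25 := mul_pos_of_lk_graphLine_eq hd hδ0 h12 (h25.trans (neg_one_mul δ).symm) (by norm_num)
  have s34 := mul_pos_of_lk_graphLine_eq hd hδ0 h12 (h34.trans (neg_one_mul δ).symm) (by norm_num)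
  have s35 := mul_pos_of_lk_graphLine_eq hd hδ0 h12 (h35.trans (one_mul δ).symm) (by norm_num)
  have s45 := mul_pos_of_lk_graphLine_eq hd hδ0 h12 (h45.trans (neg_one_mul δ).symm) (by norm_num)
  have off := @SymmTrilinear.offDiagonal_eq_zero T hT u₁ u₂ w₁ w₂ hd (k1 ▸ hTK 1) (k0 ▸ hTK 0)
    (k2 ▸ hTK 2) a₃ d₃
  have hbc4 : b₄ * c₄ = 0 := off (k3 ▸ hTK 3) ha₃.ne (by linarith) hd₃.ne' hd₃'.ne
    (k4 ▸ hTK 4) (by linarith) (by linarith) (by nlinarith [sq_nonneg (a₄ + d₄)])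
  have hbc5 : b₅ * c₅ = 0 := off (k3 ▸ hTK 3) ha₃.ne (by linarith) hd₃.ne' hd₃'.ne
    (k5 ▸ hTK 5) (by linarith) (by linarith) (by nlinarith [sq_nonneg (a₅ + d₅ - 2)])
  obtain ⟨a₄', d₄', hch, hdef⟩ := exists_deformation_chambers (a₄ := a₄) (d₄ := d₄) (a₅ := a₅)
    (d₅ := d₅) hd ha₃ hd₃ hd₃' hbc4 hbc5
    (by linarith) (by linarith) (by linarith) (by linarith) (by linarith) (by linarith)
    (by linarith)
  rw [← normalConfig_eq (K := L ∘ π) k0 k1 k2 k3 k4 k5] at hdef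
  obtain ⟨ρ, M, hM, hdef'⟩ := hch.exists_deformation hd
  have hfin := hdef.trans hdef' hdef.isLine_right
  set σ : Equiv.Perm (Fin 6) := Equiv.swap 0 1 * Equiv.swap 2 3 * Equiv.swap 4 5
  rcases hM.lt_or_gt with hM | hM
  · exact Or.inr ⟨fun i => (joinConfig σ i).map M, ⟨M, hM, fun _ => rfl⟩, π, ρ, hfin⟩
  · have hJ : PairwiseSkew (joinConfig σ ∘ ρ) := fun i j hij =>
      pairwiseSkew_joinConfig σ _ _ (ρ.injective.ne hij)
    exact Or.inl ⟨π, ρ, hfin.trans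
      (hJ.deformation_map hJ.isLine hM) hdef'.isLine_right⟩
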